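/- For every integer t ≥ 2 and sufficiently large n, sat(K_{n,n}, K_{t-1,t}) = (2t-3)n - (t-1)(t-2). -/

import Mathlib

open Finset

/-- An `n` by `n` bipartite graph, given by its edge set `E ⊆ U × U'`,
contains a copy of the complete bipartite graph with `a` vertices in `U`
and `b` vertices in `U'`. -/
def ContainsK (n : ℕ) (E : Finset (Fin n × Fin n)) (a b : ℕ) : Prop :=
  ∃ S T : Finset (Fin n), S.card = a ∧ T.card = b ∧ ∀ u ∈ S, ∀ v ∈ T, (u, v) ∈ E

/-- Contains an (unordered) copy of `K_{s,t}`. -/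
def ContainsKst (n : ℕ) (E : Finset (Fin n × Fin n)) (s t : ℕ) : Prop :=
  ContainsK n E s t ∨ ContainsK n E t s

/-- `K_{s,t}`-saturated: `K_{s,t}`-free, but adding any missing edge across
the bipartition creates a copy of `K_{s,t}`. -/
def SaturatedKst (n : ℕ) (E : Finset (Fin n × Fin n)) (s t : ℕ) : Prop :=
  ¬ ContainsKst n E s t ∧
    ∀ u v : Fin n, (u, v) ∉ E → ContainsKst n (insert (u, v) E) s t

/-- Degree of a vertex `u` on the `U` side. -/
def degU (n : ℕ) (E : Finset (Fin n × Fin n)) (u : Fin n) : ℕ :=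
  (E.filter (fun p => p.1 = u)).card

/-- Degree of a vertex `v` on the `U'` side. -/
def degV (n : ℕ) (E : Finset (Fin n × Fin n)) (v : Fin n) : ℕ :=
  (E.filter (fun p => p.2 = v)).card


section Dev
set_option linter.unusedSectionVars false
open scoped Classical

universe w₁ w₂
variable {α : Type w₁} {β : Type w₂} [Fintype α] [Fintype β]

/-- neighbourhood of `u` -/
noncomputable def nb {α : Type w₁} {β : Type w₂} [Fintype β] (R : α → β → Prop) (u : α) : Finset β :=
  univ.filter (R u)

/-- common neighbourhood of `A` -/
noncomputable def cn {α : Type w₁} {β : Type w₂} [Fintype β] (R : α → β → Prop) (A : Finset α) : Finset β :=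
  univ.filter (fun v => ∀ a ∈ A, R a v)

/-- number of edges -/
noncomputable def ed {α : Type w₁} {β : Type w₂} [Fintype α] [Fintype β] (R : α → β → Prop) : ℕ := ∑ u, #(nb R u)

theorem mem_nb {R : α → β → Prop} {u : α} {v : β} : v ∈ nb R u ↔ R u v := by simp [nb]

theorem mem_nb' {R : α → β → Prop} {u : α} {v : β} : u ∈ nb (flip R) v ↔ R u v := by
  simp [nb, flip]

theorem mem_cn {R : α → β → Prop} {A : Finset α} {v : β} : v ∈ cn R A ↔ ∀ a ∈ A, R a v := by
  simp [cn]

theorem mem_cn' {R : α → β → Prop} {B : Finset β} {u : α} :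
    u ∈ cn (flip R) B ↔ ∀ b ∈ B, R u b := by
  exact mem_cn (R := flip R)

theorem dbl (R : α → β → Prop) (S : Finset α) (T : Finset β) :
    ∑ u ∈ S, #(nb R u ∩ T) = ∑ v ∈ T, #(nb (flip R) v ∩ S) := by
  have h := Finset.sum_card_bipartiteAbove_eq_sum_card_bipartiteBelow (s := S) (t := T) R
  have h1 : ∀ u, bipartiteAbove R T u = nb R u ∩ T := by
    intro u; ext v; simp [bipartiteAbove, nb, and_comm]
  have h2 : ∀ v, bipartiteBelow R S v = nb (flip R) v ∩ S := by
    intro u; ext v; simp [bipartiteBelow, nb, flip, and_comm]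
  simpa only [h1, h2] using h

theorem ed_flip (R : α → β → Prop) : ed (flip R) = ed R := by
  have := dbl R univ univ
  simp only [inter_univ] at this
  exact this.symm

/-- splitting the edges along `A` -/
theorem ed_split (R : α → β → Prop) (A : Finset α) :
    ed R = ∑ u ∈ Aᶜ, #(nb R u) + ∑ v, #(nb (flip R) v ∩ A) := by
  have := dbl R A univ
  simp only [inter_univ] at this
  rw [← this, ed, add_comm, Finset.sum_add_sum_compl]

structure Sat (R : α → β → Prop) (k : ℕ) : Prop where
  free1 : ∀ (S : Finset α) (T : Finset β), (∀ a ∈ S, ∀ b ∈ T, R a b) →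
    k + 1 ≤ #S → k + 2 ≤ #T → False
  free2 : ∀ (S : Finset α) (T : Finset β), (∀ a ∈ S, ∀ b ∈ T, R a b) →
    k + 2 ≤ #S → k + 1 ≤ #T → False
  sat : ∀ u v, ¬ R u v → ∃ (A : Finset α) (B : Finset β), (∀ a ∈ A, R a v) ∧ (∀ b ∈ B, R u b) ∧
    (∀ a ∈ A, ∀ b ∈ B, R a b) ∧ ((#A = k + 1 ∧ #B = k) ∨ (#A = k ∧ #B = k + 1))

theorem Sat.flip {R : α → β → Prop} {k : ℕ} (h : Sat R k) : Sat (flip R) k where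
  free1 S T hc h1 h2 := h.free2 T S (fun a ha b hb => hc b hb a ha) h2 h1
  free2 S T hc h1 h2 := h.free1 T S (fun a ha b hb => hc b hb a ha) h2 h1
  sat u v hn := by
    obtain ⟨A, B, h1, h2, h3, h4⟩ := h.sat v u hn
    exact ⟨B, A, h2, h1, fun a ha b hb => h3 b hb a ha, by tauto⟩

theorem Sat.deg_ge {R : α → β → Prop} {k : ℕ} (h : Sat R k) (hn : k ≤ Fintype.card β) (u : α) :
    k ≤ #(nb R u) := by
  by_cases hu : ∃ v, ¬ R u v
  · obtain ⟨v, hv⟩ := hu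
    obtain ⟨A, B, h1, h2, h3, h4⟩ := h.sat u v hv
    have : B ⊆ nb R u := fun b hb => mem_nb.2 (h2 b hb)
    have := card_le_card this
    omega
  · push Not at hu
    have : nb R u = univ := by ext; simp [nb, hu]
    rw [this, card_univ]; exact hn

theorem caseK {R : α → β → Prop} {k n : ℕ} (h : Sat R k) (hα : Fintype.card α = n)
    (hβ : Fintype.card β = n) (hn : k ≤ n) (u0 : α) (hu0 : #(nb R u0) = k) :
    (2 * k + 1) * n ≤ ed R + k * (k + 1) := by
  set N0 := nb R u0 with hN0
  set X := cn (flip R) N0 with hX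
  have h1 : ∀ v ∈ N0ᶜ, k + 1 ≤ #(nb (flip R) v ∩ X) := by
    intro v hv
    have hv' : ¬ R u0 v := by simpa [hN0, mem_nb] using hv
    obtain ⟨A, B, h1, h2, h3, h4⟩ := h.sat u0 v hv'
    have hB : B ⊆ N0 := fun b hb => mem_nb.2 (h2 b hb)
    have hBc := card_le_card hB
    have h4' : #A = k + 1 ∧ #B = k := by omega
    have hBe : B = N0 := eq_of_subset_of_card_le hB (by omega)
    rw [← h4'.1]
    apply card_le_card
    intro a ha
    rw [mem_inter, mem_nb', hX, mem_cn', ← hBe]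
    exact ⟨h1 a ha, h3 a ha⟩
  have h2 : (n - k) * (k + 1) ≤ ∑ v ∈ N0ᶜ, #(nb (flip R) v ∩ X) := by
    have := Finset.card_nsmul_le_sum _ _ _ h1
    rwa [card_compl, hβ, hu0, smul_eq_mul] at this
  rw [← dbl] at h2
  have h3 : ∑ u ∈ X, #(nb R u ∩ N0ᶜ) + ∑ u ∈ X, k + ∑ u ∈ Xᶜ, k ≤ ed R := by
    rw [ed, ← Finset.sum_add_sum_compl X, ← sum_add_distrib]
    apply add_le_add
    · apply sum_le_sum
      intro u hu
      have : #(nb R u ∩ N0ᶜ) + #(nb R u ∩ N0) = #(nb R u) := by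
        rw [add_comm, ← sdiff_eq_inter_compl, card_inter_add_card_sdiff]
      have h5 : nb R u ∩ N0 = N0 := by
        rw [inter_eq_right]
        intro b hb
        exact mem_nb.2 (mem_cn'.1 hu b hb)
      rw [h5, hu0] at this
      omega
    · apply sum_le_sum
      intro u hu
      exact h.deg_ge (by omega) u
  rw [add_assoc, Finset.sum_add_sum_compl, sum_const, card_univ, hα, smul_eq_mul] at h3
  obtain ⟨m, rfl⟩ := Nat.exists_eq_add_of_le hn
  simp only [Nat.add_sub_cancel_left] at h2
  nlinarith


structure Ctx (R : α → β → Prop) (k n : ℕ) : Prop where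
  sat : Sat R k
  hα : Fintype.card α = n
  hβ : Fintype.card β = n
  du : ∀ u, k + 1 ≤ #(nb R u)
  dv : ∀ v, k + 1 ≤ #(nb (flip R) v)
  lt : ed R + k * (k + 1) < (2 * k + 1) * n

theorem Ctx.flip {R : α → β → Prop} {k n : ℕ} (h : Ctx R k n) : Ctx (flip R) k n where
  sat := h.sat.flip
  hα := h.hβ
  hβ := h.hα
  du := h.dv
  dv := h.du
  lt := by rw [ed_flip]; exact h.lt

/-- total excess degree outside `A` -/
noncomputable def exc {α : Type w₁} {β : Type w₂} [Fintype α] [Fintype β]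
    (R : α → β → Prop) (k : ℕ) (A : Finset α) : ℕ := ∑ u ∈ Aᶜ, (#(nb R u) - (k + 1))

theorem exc_eq {R : α → β → Prop} {k n : ℕ} (h : Ctx R k n) (A S : Finset α) (hS : S ⊆ Aᶜ) :
    ∑ u ∈ S, #(nb R u) ≤ (k + 1) * #S + exc R k A := by
  have h1 : ∑ u ∈ S, (#(nb R u) - (k + 1)) ≤ exc R k A :=
    sum_le_sum_of_subset hS
  have h2 : ∑ u ∈ S, #(nb R u) = ∑ u ∈ S, ((k + 1) + (#(nb R u) - (k + 1))) :=
    sum_congr rfl fun u _ => by have := h.du u; omega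
  rw [h2, sum_add_distrib, sum_const, smul_eq_mul]
  nlinarith

/-- degrees to a set missing `k` neighbours -/
theorem exc_eq' {R : α → β → Prop} {k n : ℕ} (h : Ctx R k n) (A S : Finset α) (hS : S ⊆ Aᶜ) :
    ∑ u ∈ S, (#(nb R u) - k) ≤ #S + exc R k A := by
  have h1 : ∑ u ∈ S, (#(nb R u) - (k + 1)) ≤ exc R k A :=
    sum_le_sum_of_subset hS
  have h2 : ∑ u ∈ S, (#(nb R u) - k) = ∑ u ∈ S, (1 + (#(nb R u) - (k + 1))) :=
    sum_congr rfl fun u _ => by have := h.du u; omega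
  rw [h2, sum_add_distrib, sum_const, smul_eq_mul]
  omega

theorem exc_single {R : α → β → Prop} {k : ℕ} (A S : Finset α) (hS : S ⊆ Aᶜ)
    (hd : ∀ u ∈ S, k + 2 ≤ #(nb R u)) : #S ≤ exc R k A := by
  have h1 : ∑ u ∈ S, (#(nb R u) - (k + 1)) ≤ exc R k A :=
    sum_le_sum_of_subset hS
  have h2 : ∑ u ∈ S, 1 ≤ ∑ u ∈ S, (#(nb R u) - (k + 1)) :=
    sum_le_sum fun u hu => by have := hd u hu; omega
  simp at h2
  omega

theorem exc_lt {R : α → β → Prop} {k n : ℕ} (h : Ctx R k n) (A : Finset α) (hA : #A = k) :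
    exc R k A < ∑ v, (k - #(nb (flip R) v ∩ A)) := by
  have h1 := ed_split R A
  have h2 : ∑ u ∈ Aᶜ, #(nb R u) = (k + 1) * #(Aᶜ) + exc R k A := by
    rw [exc, mul_comm, ← smul_eq_mul, ← sum_const, ← sum_add_distrib]
    exact sum_congr rfl fun u _ => by have := h.du u; omega
  have h3 : ∑ v, #(nb (flip R) v ∩ A) + ∑ v, (k - #(nb (flip R) v ∩ A)) = n * k := by
    rw [← sum_add_distrib, ← h.hβ, ← card_univ, ← smul_eq_mul, ← sum_const]
    exact sum_congr rfl fun v _ => by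
      have : #(nb (flip R) v ∩ A) ≤ #A := card_le_card inter_subset_right
      omega
  have h4 : k + #(Aᶜ) = n := by rw [← hA, card_add_card_compl, h.hα]
  have h5 := h.lt
  generalize #(Aᶜ) = m at *
  subst h4
  nlinarith

theorem miss_zero {R : α → β → Prop} {k : ℕ} (A : Finset α) (hA : #A = k) {v : β}
    (hv : v ∈ cn R A) : k - #(nb (flip R) v ∩ A) = 0 := by
  have : nb (flip R) v ∩ A = A := by
    rw [inter_eq_right]; intro a ha; exact mem_nb'.2 (mem_cn.1 hv a ha)
  rw [this]; omega

theorem miss_sum {R : α → β → Prop} {k : ℕ} (A : Finset α) (hA : #A = k) :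
    ∑ v, (k - #(nb (flip R) v ∩ A)) = ∑ v ∈ (cn R A)ᶜ, (k - #(nb (flip R) v ∩ A)) := by
  symm
  apply sum_subset (subset_univ _)
  intro v _ hv
  exact miss_zero A hA (by simpa using hv)

theorem exc_le {R : α → β → Prop} {k n : ℕ} (h : Ctx R k n) (A : Finset α) (hA : #A = k) :
    exc R k A ≤ k * #((cn R A)ᶜ) := by
  have h1 := exc_lt h A hA
  rw [miss_sum A hA] at h1
  have : ∑ v ∈ (cn R A)ᶜ, (k - #(nb (flip R) v ∩ A)) ≤ ∑ v ∈ (cn R A)ᶜ, k :=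
    sum_le_sum fun v _ => Nat.sub_le _ _
  rw [sum_const, smul_eq_mul, mul_comm] at this
  omega

/-- the union of neighbourhoods is bounded by the degree sum -/
theorem card_nbrs_le (R : α → β → Prop) (S : Finset α) (P : Finset β)
    (hP : ∀ v ∈ P, ∃ a ∈ S, R a v) : #P ≤ ∑ a ∈ S, #(nb R a) := by
  have : P ⊆ S.biUnion (nb R) := by
    intro v hv
    obtain ⟨a, ha, hav⟩ := hP v hv
    exact mem_biUnion.2 ⟨a, ha, mem_nb.2 hav⟩
  exact (card_le_card this).trans card_biUnion_le

/-- vertices outside `T` adjacent to `K`, whose members have `≥ k` neighbours in `T` -/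
theorem card_out_le {R : α → β → Prop} {k n : ℕ} (h : Ctx R k n) (A K : Finset α) (T P : Finset β)
    (hK : K ⊆ Aᶜ) (hKT : ∀ a ∈ K, k ≤ #(nb R a ∩ T)) (c : β → ℕ)
    (hP : ∀ v ∈ P, v ∉ T ∧ c v ≤ #(nb (flip R) v ∩ K)) :
    ∑ v ∈ P, c v ≤ #K + exc R k A := by
  calc ∑ v ∈ P, c v ≤ ∑ v ∈ P, #(nb (flip R) v ∩ K) := sum_le_sum fun v hv => (hP v hv).2
    _ ≤ ∑ v ∈ Tᶜ, #(nb (flip R) v ∩ K) :=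
        sum_le_sum_of_subset fun v hv => by simpa using (hP v hv).1
    _ = ∑ a ∈ K, #(nb R a ∩ Tᶜ) := (dbl R K Tᶜ).symm
    _ ≤ ∑ a ∈ K, (#(nb R a) - k) := by
        apply sum_le_sum
        intro a ha
        have : #(nb R a ∩ T) + #(nb R a ∩ Tᶜ) = #(nb R a) := by
          rw [← sdiff_eq_inter_compl, card_inter_add_card_sdiff]
        have := hKT a ha
        omega
    _ ≤ _ := exc_eq' h A K hK

theorem stage2a {R : α → β → Prop} {k n : ℕ} (h : Ctx R k n) (A : Finset α) (hA : #A = k)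
    (hn : (3 * k + 2) * #((cn R A)ᶜ) + 2 * (k + 1) * (k + 2) < n)
    (u : α) (huA : u ∉ A) (hud : #(nb R u) = k + 1) (w : β) (hw : R u w) (hwA : w ∉ cn R A) :
    ∃ B : Finset β, #B = k ∧ B ⊆ cn R A ∧
      #((cn (flip R) B)ᶜ) ≤ (4 * k + 2) * #((cn R A)ᶜ) + 2 * (k + 1) * (k + 2) := by
  set x := #((cn R A)ᶜ) with hx
  have hexc := exc_le h A hA
  rw [← hx] at hexc
  set Xp := cn (flip R) (nb R u) with hXp
  have hXpc : #Xp ≤ k + 1 := by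
    by_contra hcon
    exact h.sat.free2 Xp (nb R u) (fun a ha b hb => mem_cn'.1 ha b hb) (by omega) (by omega)
  set Bad := (Xp \ A).biUnion (nb R) with hBad
  have hBadc : #Bad ≤ (k + 1) * (k + 1) + exc R k A := by
    have h1 : #Bad ≤ ∑ a ∈ Xp \ A, #(nb R a) := card_biUnion_le
    have h2 := exc_eq h A (Xp \ A) (fun a ha => by simp at ha ⊢; exact ha.2)
    have h3 : #(Xp \ A) ≤ k + 1 := (card_le_card sdiff_subset).trans hXpc
    nlinarith
  set Vb := ((cn R A \ nb R u) \ Bad) with hVb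
  have hVbc : n ≤ #Vb + (x + (k + 1) + ((k + 1) * (k + 1) + exc R k A)) := by
    have h1 : (univ : Finset β) ⊆ Vb ∪ ((cn R A)ᶜ ∪ nb R u ∪ Bad) := by
      intro v _
      simp only [hVb, mem_union, mem_sdiff, mem_compl]
      tauto
    have h2 := card_le_card h1
    rw [card_univ, h.hβ] at h2
    have h3 := card_union_le Vb ((cn R A)ᶜ ∪ nb R u ∪ Bad)
    have h4 := card_union_le ((cn R A)ᶜ ∪ nb R u) Bad
    have h5 := card_union_le ((cn R A)ᶜ) (nb R u)
    omega
  set K : Finset α := univ.filter (fun a => a ∉ A ∧ a ∉ Xp ∧ k ≤ #(nb R a ∩ nb R u)) with hK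
  have hKA : K ⊆ Aᶜ := by intro a ha; simp [hK] at ha; simp [ha.1]
  have hKT : ∀ a ∈ K, k ≤ #(nb R a ∩ nb R u) := by intro a ha; simp [hK] at ha; exact ha.2.2
  have hKc : #K ≤ n := by rw [← h.hα]; exact card_le_univ _
  -- main property
  have main : ∀ v ∈ Vb, ∃ (A' : Finset α) (B' : Finset β), #A' = k + 1 ∧ #B' = k ∧ B' ⊆ nb R u ∧
      (∀ a ∈ A', R a v) ∧ (∀ a ∈ A', ∀ b ∈ B', R a b) ∧ A' \ A ⊆ K := by
    intro v hv
    simp only [hVb, mem_sdiff, mem_nb] at hv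
    obtain ⟨⟨hvA, hvu⟩, hvBad⟩ := hv
    have hnot : ∀ a ∈ Xp, R a v → a ∈ A := by
      intro a ha hav
      by_contra hcon
      exact hvBad (mem_biUnion.2 ⟨a, mem_sdiff.2 ⟨ha, hcon⟩, mem_nb.2 hav⟩)
    obtain ⟨A', B', h1, h2, h3, h4⟩ := h.sat.sat u v hvu
    have hB : B' ⊆ nb R u := fun b hb => mem_nb.2 (h2 b hb)
    rcases h4 with h4 | h4
    · refine ⟨A', B', h4.1, h4.2, hB, h1, h3, ?_⟩
      intro a ha
      rw [mem_sdiff] at ha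
      simp only [hK, mem_filter, mem_univ, true_and]
      refine ⟨ha.2, fun hX => ha.2 (hnot a hX (h1 a ha.1)), ?_⟩
      rw [← h4.2]
      exact card_le_card fun b hb => mem_inter.2 ⟨mem_nb.2 (h3 a ha.1 b hb), hB hb⟩
    · exfalso
      have hBe : B' = nb R u := eq_of_subset_of_card_le hB (by omega)
      have hA' : A' ⊆ A := by
        intro a ha
        refine hnot a ?_ (h1 a ha)
        rw [hXp, mem_cn', ← hBe]; exact h3 a ha
      have hAe : A' = A := eq_of_subset_of_card_le hA' (by omega)
      apply hwA
      rw [mem_cn, ← hAe]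
      intro a ha
      exact h3 a ha w (by rw [hBe]; exact mem_nb.2 hw)
  set B := nb R u ∩ cn R A with hBdef
  have hBlt : #B ≤ k := by
    have : B ⊆ (nb R u).erase w := by
      intro b hb
      rw [hBdef, mem_inter] at hb
      refine mem_erase.2 ⟨?_, hb.1⟩
      rintro rfl; exact hwA hb.2
    have := card_le_card this
    rw [card_erase_of_mem (mem_nb.2 hw)] at this
    omega
  set V1 := Vb.filter (fun v => #B = k ∧ ∃ a ∈ K, R a v ∧ ∀ b ∈ B, R a b) with hV1
  have hcase : ∀ v ∈ Vb, v ∉ V1 → 2 ≤ #(nb (flip R) v ∩ K) := by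
    intro v hv hv1
    obtain ⟨A', B', hA'c, hB'c, hB'u, h1, h3, hAK⟩ := main v hv
    have hsub : A' \ A ⊆ nb (flip R) v ∩ K := fun a ha =>
      mem_inter.2 ⟨mem_nb'.2 (h1 a (mem_sdiff.1 ha).1), hAK ha⟩
    refine le_trans ?_ (card_le_card hsub)
    by_contra hcon
    have h5 : #(A' ∩ A) + #(A' \ A) = #A' := card_inter_add_card_sdiff _ _
    have h6 : #(A' ∩ A) ≤ #A := card_le_card inter_subset_right
    have h7 : A' ∩ A = A := eq_of_subset_of_card_le inter_subset_right (by omega)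
    have hAA' : A ⊆ A' := inter_eq_right.1 h7
    have hB'B : B' ⊆ B := fun b hb => mem_inter.2 ⟨hB'u hb, mem_cn.2 fun a ha => h3 a (hAA' ha) b hb⟩
    have hBe : B' = B := eq_of_subset_of_card_le hB'B (by omega)
    have : (A' \ A).Nonempty := by rw [← card_pos]; omega
    obtain ⟨a, ha⟩ := this
    apply hv1
    rw [hV1, mem_filter]
    refine ⟨hv, hBe ▸ hB'c, a, hAK ha, h1 a (mem_sdiff.1 ha).1, ?_⟩
    rw [← hBe]; exact h3 a (mem_sdiff.1 ha).1
  have hcase1 : ∀ v ∈ V1, 1 ≤ #(nb (flip R) v ∩ K) := by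
    intro v hv
    rw [hV1, mem_filter] at hv
    obtain ⟨_, _, a, ha, hav, _⟩ := hv
    exact card_pos.2 ⟨a, mem_inter.2 ⟨mem_nb'.2 hav, ha⟩⟩
  have hVbu : ∀ v ∈ Vb, v ∉ nb R u := by
    intro v hv; simp only [hVb, mem_sdiff] at hv; exact hv.1.2
  have hcount := card_out_le h A K (nb R u) Vb hKA hKT (fun v => if v ∈ V1 then 1 else 2) (by
    intro v hv
    refine ⟨hVbu v hv, ?_⟩
    by_cases hv1 : v ∈ V1
    · simpa [hv1] using hcase1 v hv1
    · simpa [hv1] using hcase v hv hv1)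
  have hV1sub : V1 ⊆ Vb := filter_subset _ _
  have hsum : ∑ v ∈ Vb, (if v ∈ V1 then 1 else 2) + #V1 = 2 * #Vb := by
    have : #V1 = ∑ v ∈ Vb, (if v ∈ V1 then 1 else 0) := by
      rw [← sum_filter, sum_const, smul_eq_mul, mul_one]
      congr 1
      ext v; simp only [mem_filter]; exact ⟨fun hh => ⟨hV1sub hh, hh⟩, fun hh => hh.2⟩
    rw [this, ← sum_add_distrib, mul_comm, ← smul_eq_mul, ← sum_const]
    apply sum_congr rfl
    intro v _; split_ifs <;> rfl
  have hV1c : 2 * #Vb ≤ #V1 + n + exc R k A := by omega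
  have hne : V1.Nonempty := by
    rw [← card_pos]
    nlinarith
  have hBk : #B = k := by
    obtain ⟨v, hv⟩ := hne
    rw [hV1, mem_filter] at hv; exact hv.2.1
  refine ⟨B, hBk, inter_subset_right, ?_⟩
  have hcount2 := card_out_le h A (K ∩ cn (flip R) B) (nb R u) V1
    (inter_subset_left.trans hKA) (fun a ha => hKT a (mem_inter.1 ha).1) (fun _ => 1) (by
    intro v hv
    refine ⟨hVbu v (hV1sub hv), ?_⟩
    rw [hV1, mem_filter] at hv
    obtain ⟨_, _, a, ha, hav, haB⟩ := hv
    exact card_pos.2 ⟨a, mem_inter.2 ⟨mem_nb'.2 hav, mem_inter.2 ⟨ha, mem_cn'.2 haB⟩⟩⟩)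
  rw [sum_const, smul_eq_mul, mul_one] at hcount2
  have h8 : #(K ∩ cn (flip R) B) ≤ #(cn (flip R) B) := card_le_card inter_subset_right
  have h9 : #(cn (flip R) B) + #((cn (flip R) B)ᶜ) = n := by rw [card_add_card_compl, h.hα]
  nlinarith


theorem stage2b {R : α → β → Prop} {k n : ℕ} (h : Ctx R k n) (A : Finset α) (hA : #A = k)
    (hn : k * #((cn R A)ᶜ) + k < n)
    (hT : ∀ u, u ∉ A → ∀ w, R u w → w ∉ cn R A → k + 2 ≤ #(nb R u)) :
    ∃ B : Finset β, #B = k ∧ B ⊆ cn R A ∧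
      #((cn (flip R) B)ᶜ) ≤ (k * (k + 3) + 1) * #((cn R A)ᶜ) + k := by
  set x := #((cn R A)ᶜ) with hx
  have hexc := exc_le h A hA
  rw [← hx] at hexc
  -- a vertex of degree `k+1` outside `A`
  have hu : ∃ u, u ∉ A ∧ #(nb R u) = k + 1 := by
    by_contra hcon
    push Not at hcon
    have h1 := exc_single (R := R) (k := k) A Aᶜ (Subset.refl _) (by
      intro u hu
      have h1 := h.du u
      have h2 := hcon u (by simpa using hu)
      omega)
    have h2 : #A + #(Aᶜ) = n := by rw [card_add_card_compl, h.hα]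
    omega
  obtain ⟨u, huA, hud⟩ := hu
  have hNu : nb R u ⊆ cn R A := by
    intro w hw
    by_contra hcon
    have := hT u huA w (mem_nb.1 hw) hcon
    omega
  set D0 : Finset α := univ.filter (fun a => a ∉ A ∧ k ≤ #(nb R a ∩ cn R A) ∧
    1 ≤ #(nb R a ∩ (cn R A)ᶜ)) with hD0
  have hD0A : D0 ⊆ Aᶜ := by intro a ha; simp [hD0] at ha; simp [ha.1]
  have key : ∀ v ∈ (cn R A)ᶜ, k - #(nb (flip R) v ∩ A) ≤ #(nb (flip R) v ∩ D0) := by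
    intro v hv
    have hv' := hv
    rw [mem_compl] at hv
    have hvu : ¬ R u v := fun hh => hv (hNu (mem_nb.2 hh))
    obtain ⟨A', B', h1, h2, h3, h4⟩ := h.sat.sat u v hvu
    have hB : B' ⊆ nb R u := fun b hb => mem_nb.2 (h2 b hb)
    rcases h4 with h4 | h4
    · have hsub : A' \ A ⊆ nb (flip R) v ∩ D0 := by
        intro a ha
        rw [mem_sdiff] at ha
        simp only [hD0, mem_inter, mem_nb', mem_filter, mem_univ, true_and]
        refine ⟨h1 a ha.1, ha.2, ?_, ?_⟩
        · rw [← h4.2]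
          exact card_le_card fun b hb => mem_inter.2 ⟨mem_nb.2 (h3 a ha.1 b hb), hNu (hB hb)⟩
        · exact card_pos.2 ⟨v, mem_inter.2 ⟨mem_nb.2 (h1 a ha.1), hv'⟩⟩
      have h5 : #(A' ∩ A) + #(A' \ A) = #A' := card_inter_add_card_sdiff _ _
      have h6 : #(A' ∩ A) ≤ #(nb (flip R) v ∩ A) := card_le_card fun a ha => by
        rw [mem_inter] at ha ⊢
        exact ⟨mem_nb'.2 (h1 a ha.1), ha.2⟩
      have h7 := card_le_card hsub
      omega
    · exfalso
      have hBe : B' = nb R u := eq_of_subset_of_card_le hB (by omega)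
      by_cases hAA : A ⊆ A'
      · have hAe : A = A' := eq_of_subset_of_card_le hAA (by omega)
        apply hv
        rw [mem_cn, hAe]; exact h1
      · obtain ⟨a0, ha0, ha0'⟩ := not_subset.1 hAA
        have huA' : u ∉ A' := fun hh => hvu (h1 u hh)
        have hne : a0 ∉ insert u A' := by
          simp only [mem_insert, not_or]
          exact ⟨fun hh => huA (hh ▸ ha0), ha0'⟩
        refine h.sat.free2 (insert a0 (insert u A')) (nb R u) ?_ ?_ (by omega)
        · intro a ha b hb
          rw [mem_insert, mem_insert] at ha
          rcases ha with rfl | rfl | ha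
          · exact mem_cn.1 (hNu hb) _ ha0
          · exact mem_nb.1 hb
          · exact h3 a ha b (by rw [hBe]; exact hb)
        · rw [card_insert_of_notMem hne, card_insert_of_notMem huA']
          omega
  have hex : ∃ a ∈ D0, #(nb R a ∩ cn R A) = k := by
    by_contra hcon
    push Not at hcon
    have h1 := exc_lt h A hA
    rw [miss_sum A hA] at h1
    have h2 := sum_le_sum key
    rw [← dbl] at h2
    have h3 : ∑ a ∈ D0, #(nb R a ∩ (cn R A)ᶜ) ≤ ∑ a ∈ D0, (#(nb R a) - (k + 1)) := by
      apply sum_le_sum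
      intro a ha
      have h4 := hcon a ha
      have h5 : k ≤ #(nb R a ∩ cn R A) := by simp [hD0] at ha; exact ha.2.1
      have : #(nb R a ∩ cn R A) + #(nb R a ∩ (cn R A)ᶜ) = #(nb R a) := by
        rw [← sdiff_eq_inter_compl, card_inter_add_card_sdiff]
      omega
    have h4 : ∑ a ∈ D0, (#(nb R a) - (k + 1)) ≤ exc R k A := sum_le_sum_of_subset hD0A
    omega
  obtain ⟨a, haD, hak⟩ := hex
  set B := nb R a ∩ cn R A with hB
  refine ⟨B, hak, inter_subset_right, ?_⟩
  set Hi : Finset α := univ.filter (fun c => c ∉ A ∧ k + 2 ≤ #(nb R c)) with hHi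
  set Bad := Hi.biUnion (nb R) with hBad
  have hBadc : #Bad ≤ (k + 2) * exc R k A := by
    have hs : Hi ⊆ Aᶜ := by intro c hc; simp [hHi] at hc; simp [hc.1]
    have h1 : #Bad ≤ ∑ a ∈ Hi, #(nb R a) := card_biUnion_le
    have h2 := exc_eq h A Hi hs
    have h3 : #Hi ≤ exc R k A := exc_single A Hi hs (by intro c hc; simp [hHi] at hc; exact hc.2)
    nlinarith
  set Vg := (cn R A \ B) \ Bad with hVg
  have hVgc : n ≤ #Vg + (x + k + (k + 2) * exc R k A) := by
    have h1 : (univ : Finset β) ⊆ Vg ∪ ((cn R A)ᶜ ∪ B ∪ Bad) := by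
      intro v _
      simp only [hVg, mem_union, mem_sdiff, mem_compl]
      tauto
    have h2 := card_le_card h1
    rw [card_univ, h.hβ] at h2
    have h3 := card_union_le Vg ((cn R A)ᶜ ∪ B ∪ Bad)
    have h4 := card_union_le ((cn R A)ᶜ ∪ B) Bad
    have h5 := card_union_le ((cn R A)ᶜ) B
    omega
  have hcount := card_out_le h A (cn (flip R) B \ A) B Vg
    (fun c hc => by simp at hc ⊢; exact hc.2)
    (fun c hc => by
      have : nb R c ∩ B = B := by
        rw [inter_eq_right]; intro b hb; exact mem_nb.2 (mem_cn'.1 (mem_sdiff.1 hc).1 b hb)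
      rw [this]; omega) (fun _ => 1) (by
    intro v hv
    simp only [hVg, mem_sdiff] at hv
    obtain ⟨⟨hvA, hvB⟩, hvBad⟩ := hv
    refine ⟨hvB, ?_⟩
    have hnav : ¬ R a v := fun hh => hvB (mem_inter.2 ⟨mem_nb.2 hh, hvA⟩)
    obtain ⟨A', B', h1, h2, h3, h4⟩ := h.sat.sat a v hnav
    by_cases hBV : B' ⊆ cn R A
    · have hB'B : B' ⊆ B := fun b hb => mem_inter.2 ⟨mem_nb.2 (h2 b hb), hBV hb⟩
      have := card_le_card hB'B
      have h4' : #A' = k + 1 ∧ #B' = k := by omega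
      have hBe : B' = B := eq_of_subset_of_card_le hB'B (by omega)
      have : ∃ c ∈ A', c ∉ A := by
        by_contra hcon
        push Not at hcon
        have : A' ⊆ A := hcon
        have := card_le_card this
        omega
      obtain ⟨c, hc, hcA⟩ := this
      refine card_pos.2 ⟨c, mem_inter.2 ⟨mem_nb'.2 (h1 c hc), mem_sdiff.2 ⟨mem_cn'.2 ?_, hcA⟩⟩⟩
      rw [← hBe]; exact h3 c hc
    · exfalso
      obtain ⟨w, hw, hwA⟩ := not_subset.1 hBV
      have : ∃ c ∈ A', c ∉ A := by
        by_contra hcon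
        push Not at hcon
        have hs : A' ⊆ A := hcon
        have hAe : A' = A := eq_of_subset_of_card_le hs (by omega)
        apply hwA
        rw [mem_cn, ← hAe]
        intro c hc
        exact h3 c hc w hw
      obtain ⟨c, hc, hcA⟩ := this
      apply hvBad
      refine mem_biUnion.2 ⟨c, ?_, mem_nb.2 (h1 c hc)⟩
      simp only [hHi, mem_filter, mem_univ, true_and]
      exact ⟨hcA, hT c hcA w (h3 c hc w hw) hwA⟩)
  rw [sum_const, smul_eq_mul, mul_one] at hcount
  have h8 : #(cn (flip R) B \ A) ≤ #(cn (flip R) B) := card_le_card sdiff_subset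
  have h9 : #(cn (flip R) B) + #((cn (flip R) B)ᶜ) = n := by rw [card_add_card_compl, h.hα]
  have h10 : #((cn (flip R) B)ᶜ) ≤ x + k + (k + 3) * exc R k A := by nlinarith
  have h11 : (k + 3) * exc R k A ≤ (k + 3) * (k * x) := Nat.mul_le_mul_left _ hexc
  nlinarith

theorem stage2 {R : α → β → Prop} {k n : ℕ} (h : Ctx R k n) (A : Finset α) (hA : #A = k)
    (hn : (3 * k + 2) * #((cn R A)ᶜ) + 2 * (k + 1) * (k + 2) < n) :
    ∃ B : Finset β, #B = k ∧ B ⊆ cn R A ∧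
      #((cn (flip R) B)ᶜ) ≤ (k * k + 7 * k + 3) * #((cn R A)ᶜ) + 2 * (k + 1) * (k + 2) := by
  by_cases hT : ∀ u, u ∉ A → ∀ w, R u w → w ∉ cn R A → k + 2 ≤ #(nb R u)
  · obtain ⟨B, h1, h2, h3⟩ := stage2b h A hA (by nlinarith) hT
    exact ⟨B, h1, h2, by nlinarith⟩
  · push Not at hT
    obtain ⟨u, hu, w, hw, hwA, hd⟩ := hT
    obtain ⟨B, h1, h2, h3⟩ := stage2a h A hA hn u hu (by have := h.du u; omega) w hw hwA
    exact ⟨B, h1, h2, by nlinarith⟩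

theorem stage3 {R : α → β → Prop} {k n : ℕ} (h : Ctx R k n) (A : Finset α) (hA : #A = k)
    (B : Finset β) (hB : #B = k) (hAB : ∀ a ∈ A, ∀ b ∈ B, R a b)
    (hn : (k * k + 4 * k + 2) * (#((cn R A)ᶜ) + #((cn (flip R) B)ᶜ)) + k < n) :
    ∀ v, v ∉ cn R A → k + 1 ≤ #(nb (flip R) v ∩ cn (flip R) B) := by
  have hexU := exc_le h A hA
  have hexV := exc_le h.flip B hB
  have hff : cn (flip (flip R)) = cn R := rfl
  set x := #((cn R A)ᶜ) with hx
  set y := #((cn (flip R) B)ᶜ) with hy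
  have hBA : B ⊆ cn R A := fun b hb => mem_cn.2 fun a ha => hAB a ha b hb
  set Hi : Finset β := univ.filter (fun c => c ∉ B ∧ k + 2 ≤ #(nb (flip R) c)) with hHi
  set HiU : Finset α := univ.filter (fun c => c ∉ A ∧ k + 2 ≤ #(nb R c)) with hHiU
  set Y := (cn R A)ᶜ ∪ Hi with hY
  have hYB : Y ⊆ Bᶜ := by
    intro v hv
    rw [mem_compl]
    intro hvB
    rw [hY, mem_union, mem_compl] at hv
    rcases hv with hv | hv
    · exact hv (hBA hvB)
    · simp [hHi] at hv; exact hv.1 hvB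
  have hHic : #Hi ≤ exc (flip R) k B := exc_single B Hi (by
    intro c hc; simp [hHi] at hc; simp [hc.1]) (by intro c hc; simp [hHi] at hc; exact hc.2)
  have hHiUc : #HiU ≤ exc R k A := exc_single A HiU (by
    intro c hc; simp [hHiU] at hc; simp [hc.1]) (by intro c hc; simp [hHiU] at hc; exact hc.2)
  set Bad := Y.biUnion (nb (flip R)) with hBad
  have hBadc : #Bad ≤ (k + 1) * x + (k + 2) * exc (flip R) k B := by
    have h1 : #Bad ≤ ∑ a ∈ Y, #(nb (flip R) a) := card_biUnion_le
    have h2 := exc_eq h.flip B Y hYB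
    have h3 : #Y ≤ x + #Hi := card_union_le _ _
    nlinarith
  have hex : ∃ u, u ∉ A ∪ (cn (flip R) B)ᶜ ∪ HiU ∪ Bad := by
    by_contra hcon
    push Not at hcon
    have h1 : (univ : Finset α) ⊆ A ∪ (cn (flip R) B)ᶜ ∪ HiU ∪ Bad := fun u _ => hcon u
    have h2 := card_le_card h1
    rw [card_univ, h.hα] at h2
    have h3 := card_union_le (A ∪ (cn (flip R) B)ᶜ ∪ HiU) Bad
    have h4 := card_union_le (A ∪ (cn (flip R) B)ᶜ) HiU
    have h5 := card_union_le A ((cn (flip R) B)ᶜ)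
    have h6 : (k + 2) * exc (flip R) k B ≤ (k + 2) * (k * y) := Nat.mul_le_mul_left _ hexV
    nlinarith
  obtain ⟨u, hu⟩ := hex
  simp only [mem_union, mem_compl, not_or, not_not] at hu
  obtain ⟨⟨⟨huA, huB⟩, huHi⟩, huBad⟩ := hu
  have hud : #(nb R u) = k + 1 := by
    have := h.du u
    simp [hHiU] at huHi
    have := huHi huA
    omega
  have hBu : B ⊆ nb R u := fun b hb => mem_nb.2 (mem_cn'.1 huB b hb)
  have hnY : ∀ w, R u w → w ∈ cn R A ∧ (w ∉ B → #(nb (flip R) w) = k + 1) := by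
    intro w hw
    have hwY : w ∉ Y := fun hh => huBad (mem_biUnion.2 ⟨w, hh, mem_nb'.2 hw⟩)
    simp only [hY, mem_union, mem_compl, not_or, not_not] at hwY
    refine ⟨hwY.1, fun hwB => ?_⟩
    have := hwY.2
    simp [hHi] at this
    have := this hwB
    have := h.dv w
    omega
  -- neighbours outside `B` have neighbourhood `insert u A`
  have hNm : ∀ w, R u w → w ∉ B → nb (flip R) w = insert u A := by
    intro w hw hwB
    obtain ⟨h1, h2⟩ := hnY w hw
    symm
    apply eq_of_subset_of_card_le
    · intro a ha
      rw [mem_insert] at ha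
      rcases ha with rfl | ha
      · exact mem_nb'.2 hw
      · exact mem_nb'.2 (mem_cn.1 h1 a ha)
    · rw [card_insert_of_notMem huA, h2 hwB, hA]
  intro v hv
  have huv : ¬ R u v := fun hh => hv (hnY v hh).1
  obtain ⟨A', B', h1, h2, h3, h4⟩ := h.sat.sat u v huv
  by_cases hBB : B' ⊆ B
  · have := card_le_card hBB
    have h4' : #A' = k + 1 ∧ #B' = k := by omega
    have hBe : B' = B := eq_of_subset_of_card_le hBB (by omega)
    rw [← h4'.1]
    refine card_le_card fun a ha => mem_inter.2 ⟨mem_nb'.2 (h1 a ha), mem_cn'.2 ?_⟩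
    rw [← hBe]; exact h3 a ha
  · exfalso
    obtain ⟨w, hw, hwB⟩ := not_subset.1 hBB
    have hNw := hNm w (h2 w hw) hwB
    have hA'A : A' ⊆ A := by
      intro a ha
      have : a ∈ nb (flip R) w := mem_nb'.2 (h3 a ha w hw)
      rw [hNw, mem_insert] at this
      rcases this with rfl | this
      · exact absurd (h1 _ ha) huv
      · exact this
    have hAe : A' = A := eq_of_subset_of_card_le hA'A (by omega)
    apply hv
    rw [mem_cn, ← hAe]; exact h1


theorem stage4A {R : α → β → Prop} {k n : ℕ} (h : Ctx R k n) (A : Finset α) (hA : #A = k)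
    (B : Finset β) (hB : #B = k) (hAB : ∀ a ∈ A, ∀ b ∈ B, R a b)
    (hV : ∀ v, v ∉ cn R A → k + 1 ≤ #(nb (flip R) v ∩ cn (flip R) B)) :
    ∑ u ∈ (cn (flip R) B)ᶜ, #(nb R u ∩ (cn R A \ B)) + ∑ u ∈ (cn (flip R) B)ᶜ, #(nb R u ∩ (cn R A)ᶜ)
      < #((cn R A \ B).filter (fun p => nb (flip R) p ∩ (cn (flip R) B \ A) = ∅))
        + ∑ u ∈ (cn (flip R) B)ᶜ, (k - #(nb R u ∩ B)) := by
  set P := cn (flip R) B \ A with hP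
  set Q := cn R A \ B with hQ
  set U' := (cn (flip R) B)ᶜ with hU'
  set V' := (cn R A)ᶜ with hV'
  set G0 := Q.filter (fun p => nb (flip R) p ∩ P = ∅) with hG0
  have hBA : B ⊆ cn R A := fun b hb => mem_cn.2 fun a ha => hAB a ha b hb
  have hAB' : A ⊆ cn (flip R) B := fun a ha => mem_cn'.2 fun b hb => hAB a ha b hb
  have hAc : Aᶜ = P ∪ U' := by
    ext a; simp only [hP, hU', mem_union, mem_sdiff, mem_compl]
    have := @hAB' a; tauto
  have hPU : Disjoint P U' := by
    rw [disjoint_left]; intro a; simp only [hP, hU', mem_sdiff, mem_compl]; tauto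
  have hBc : Bᶜ = Q ∪ V' := by
    ext a; simp only [hQ, hV', mem_union, mem_sdiff, mem_compl]
    have := @hBA a; tauto
  have hQV : Disjoint Q V' := by
    rw [disjoint_left]; intro a; simp only [hQ, hV', mem_sdiff, mem_compl]; tauto
  have e1 := exc_lt h A hA
  rw [miss_sum A hA] at e1
  have e2 : exc R k A + (k + 1) * #(Aᶜ) = ∑ u ∈ Aᶜ, #(nb R u) := by
    rw [exc, mul_comm, ← smul_eq_mul, ← sum_const, ← sum_add_distrib]
    exact sum_congr rfl fun u _ => by have := h.du u; omega
  have e3 : ∀ u, #(nb R u) = #(nb R u ∩ B) + (#(nb R u ∩ Q) + #(nb R u ∩ V')) := by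
    intro u
    have h1 : #(nb R u ∩ B) + #(nb R u ∩ Bᶜ) = #(nb R u) := by
      rw [← sdiff_eq_inter_compl, card_inter_add_card_sdiff]
    rw [hBc, inter_union_distrib_left, card_union_of_disjoint
      (disjoint_of_subset_left inter_subset_right
        (disjoint_of_subset_right inter_subset_right hQV))] at h1
    omega
  have e4 : ∑ u ∈ Aᶜ, #(nb R u) = ∑ u ∈ P, #(nb R u) + ∑ u ∈ U', #(nb R u) := by
    rw [hAc, sum_union hPU]
  have e5 : ∑ u ∈ P, #(nb R u) = #P * k + ∑ u ∈ P, #(nb R u ∩ Q) + ∑ u ∈ P, #(nb R u ∩ V') := by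
    rw [← smul_eq_mul, ← sum_const, ← sum_add_distrib, ← sum_add_distrib]
    apply sum_congr rfl
    intro u hu
    have h1 : nb R u ∩ B = B := by
      rw [inter_eq_right]; intro b hb
      exact mem_nb.2 (mem_cn'.1 (mem_sdiff.1 hu).1 b hb)
    have := e3 u
    rw [h1, hB] at this
    omega
  have e6 : ∑ u ∈ U', #(nb R u) + ∑ u ∈ U', (k - #(nb R u ∩ B)) =
      #U' * k + ∑ u ∈ U', #(nb R u ∩ Q) + ∑ u ∈ U', #(nb R u ∩ V') := by
    rw [← smul_eq_mul, ← sum_const, ← sum_add_distrib, ← sum_add_distrib, ← sum_add_distrib]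
    apply sum_congr rfl
    intro u hu
    have h1 : #(nb R u ∩ B) ≤ #B := card_le_card inter_subset_right
    have := e3 u
    omega
  have e7 : #(Aᶜ) = #P + #U' := by rw [hAc, card_union_of_disjoint hPU]
  have e8 : #(Bᶜ) = #Q + #V' := by rw [hBc, card_union_of_disjoint hQV]
  have e9 : #A + #(Aᶜ) = n := by rw [card_add_card_compl, h.hα]
  have e10 : #B + #(Bᶜ) = n := by rw [card_add_card_compl, h.hβ]
  have e11 : ∑ v ∈ V', (k - #(nb (flip R) v ∩ A)) + #V' ≤ ∑ u ∈ P, #(nb R u ∩ V') := by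
    rw [dbl, card_eq_sum_ones, ← sum_add_distrib]
    apply sum_le_sum
    intro v hv
    have h1 := hV v (by simpa [hV'] using hv)
    have h2 : #(nb (flip R) v ∩ cn (flip R) B) ≤ #(nb (flip R) v ∩ A) + #(nb (flip R) v ∩ P) := by
      refine le_trans (card_le_card ?_) (card_union_le _ _)
      intro a; simp only [hP, mem_inter, mem_union, mem_sdiff]; tauto
    have h0 : #(nb (flip R) v ∩ A) ≤ #A := card_le_card inter_subset_right
    omega
  have e12 : #Q ≤ #G0 + ∑ u ∈ P, #(nb R u ∩ Q) := by
    rw [dbl]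
    have h1 : #G0 = ∑ p ∈ Q, if nb (flip R) p ∩ P = ∅ then 1 else 0 := by
      rw [hG0, card_filter]
    rw [h1, ← sum_add_distrib, card_eq_sum_ones]
    apply sum_le_sum
    intro p _
    split_ifs with hh
    · omega
    · have := card_pos.2 (nonempty_iff_ne_empty.2 hh); omega
  rw [e7] at e2 e9
  nlinarith

theorem stage4 {R : α → β → Prop} {k n : ℕ} (h : Ctx R k n) (A : Finset α) (hA : #A = k)
    (B : Finset β) (hB : #B = k) (hAB : ∀ a ∈ A, ∀ b ∈ B, R a b)
    (hV : ∀ v, v ∉ cn R A → k + 1 ≤ #(nb (flip R) v ∩ cn (flip R) B))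
    (hU : ∀ u, u ∉ cn (flip R) B → k + 1 ≤ #(nb R u ∩ cn R A)) : False := by
  have main := stage4A h A hA B hB hAB hV
  have main' := stage4A h.flip B hB A hA (fun b hb a ha => hAB a ha b hb) hU
  have hBA : B ⊆ cn R A := fun b hb => mem_cn.2 fun a ha => hAB a ha b hb
  have hAB' : A ⊆ cn (flip R) B := fun a ha => mem_cn'.2 fun b hb => hAB a ha b hb
  have hgU : ∀ u ∈ (cn (flip R) B)ᶜ, k - #(nb R u ∩ B) ≤ #(nb R u ∩ (cn R A \ B)) := by
    intro u hu
    have h1 := hU u (by simpa using hu)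
    have h2 : #(nb R u ∩ cn R A) ≤ #(nb R u ∩ B) + #(nb R u ∩ (cn R A \ B)) := by
      refine le_trans (card_le_card ?_) (card_union_le _ _)
      intro a; simp only [mem_inter, mem_union, mem_sdiff]; tauto
    omega
  have hgV : ∀ v ∈ (cn R A)ᶜ, k - #(nb (flip R) v ∩ A) ≤
      #(nb (flip R) v ∩ (cn (flip R) B \ A)) := by
    intro u hu
    have h1 := hV u (by simpa using hu)
    have h2 : #(nb (flip R) u ∩ cn (flip R) B) ≤ #(nb (flip R) u ∩ A) +
        #(nb (flip R) u ∩ (cn (flip R) B \ A)) := by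
      refine le_trans (card_le_card ?_) (card_union_le _ _)
      intro a; simp only [mem_inter, mem_union, mem_sdiff]; tauto
    omega
  -- pick q
  have hq : ∃ q, q ∈ (cn (flip R) B \ A).filter (fun p => nb R p ∩ (cn R A \ B) = ∅) := by
    by_contra hcon
    push Not at hcon
    have h1 : (cn (flip R) B \ A).filter (fun p => nb R p ∩ (cn R A \ B) = ∅) = ∅ :=
      eq_empty_of_forall_notMem hcon
    have h2 := sum_le_sum hgV
    have h3 : #((cn (flip R) B \ A).filter (fun p => nb R p ∩ (cn R A \ B) = ∅)) = 0 := by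
      rw [h1]; rfl
    change _ < #((cn (flip R) B \ A).filter (fun p => nb R p ∩ (cn R A \ B) = ∅)) +
      ∑ v ∈ (cn R A)ᶜ, (k - #(nb (flip R) v ∩ A)) at main'
    change ∑ v ∈ (cn R A)ᶜ, #(nb (flip R) v ∩ (cn (flip R) B \ A)) + _ < _ at main'
    omega
  obtain ⟨q, hq⟩ := hq
  rw [mem_filter, mem_sdiff] at hq
  obtain ⟨⟨hqB, hqA⟩, hqQ⟩ := hq
  set Us := ((cn (flip R) B)ᶜ).filter (fun u => k - #(nb R u ∩ B) ≤ #(nb R u ∩ (cn R A)ᶜ)) with hUs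
  have hG : ∀ p ∈ (cn R A \ B).filter (fun p => nb (flip R) p ∩ (cn (flip R) B \ A) = ∅),
      ∃ u ∈ Us, R u p := by
    intro p hp
    rw [mem_filter, mem_sdiff] at hp
    obtain ⟨⟨hpA, hpB⟩, hpP⟩ := hp
    have hqp : ¬ R q p := by
      intro hh
      have : p ∈ nb R q ∩ (cn R A \ B) := mem_inter.2 ⟨mem_nb.2 hh, mem_sdiff.2 ⟨hpA, hpB⟩⟩
      rw [hqQ] at this; exact absurd this (notMem_empty _)
    obtain ⟨A', B', h1, h2, h3, h4⟩ := h.sat.sat q p hqp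
    have hA' : ∀ a ∈ A', a ∉ A → a ∈ (cn (flip R) B)ᶜ := by
      intro a ha haA
      rw [mem_compl]
      intro haB
      have : a ∈ nb (flip R) p ∩ (cn (flip R) B \ A) :=
        mem_inter.2 ⟨mem_nb'.2 (h1 a ha), mem_sdiff.2 ⟨haB, haA⟩⟩
      rw [hpP] at this; exact absurd this (notMem_empty _)
    have hB' : ∀ b ∈ B', b ∉ B → b ∈ (cn R A)ᶜ := by
      intro b hb hbB
      rw [mem_compl]
      intro hbA
      have : b ∈ nb R q ∩ (cn R A \ B) :=
        mem_inter.2 ⟨mem_nb.2 (h2 b hb), mem_sdiff.2 ⟨hbA, hbB⟩⟩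
      rw [hqQ] at this; exact absurd this (notMem_empty _)
    have hex : ∃ u ∈ A', u ∉ A := by
      by_contra hcon
      push Not at hcon
      have hs : A' ⊆ A := hcon
      have hc := card_le_card hs
      have hAe : A' = A := eq_of_subset_of_card_le hs (by omega)
      have : ∃ b ∈ B', b ∉ B := by
        by_contra hcon
        push Not at hcon
        have hs : B' ⊆ B := hcon
        have hc := card_le_card hs
        omega
      obtain ⟨b, hb, hbB⟩ := this
      have := hB' b hb hbB
      rw [mem_compl] at this
      apply this
      rw [mem_cn, ← hAe]
      intro a ha; exact h3 a ha b hb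
    obtain ⟨u, hu, huA⟩ := hex
    refine ⟨u, ?_, h1 u hu⟩
    rw [hUs, mem_filter]
    refine ⟨hA' u hu huA, ?_⟩
    have h5 : #B' ≤ #(nb R u ∩ B) + #(nb R u ∩ (cn R A)ᶜ) := by
      refine le_trans (card_le_card ?_) (card_union_le _ _)
      intro b hb
      have hub : b ∈ nb R u := mem_nb.2 (h3 u hu b hb)
      by_cases hbB : b ∈ B
      · exact mem_union_left _ (mem_inter.2 ⟨hub, hbB⟩)
      · exact mem_union_right _ (mem_inter.2 ⟨hub, hB' b hb hbB⟩)
    omega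
  -- counting
  have hUsub : Us ⊆ (cn (flip R) B)ᶜ := filter_subset _ _
  have c1 : #((cn R A \ B).filter (fun p => nb (flip R) p ∩ (cn (flip R) B \ A) = ∅)) ≤
      ∑ u ∈ Us, #(nb R u ∩ (cn R A \ B)) := by
    have : (cn R A \ B).filter (fun p => nb (flip R) p ∩ (cn (flip R) B \ A) = ∅) ⊆
        Us.biUnion (fun u => nb R u ∩ (cn R A \ B)) := by
      intro p hp
      obtain ⟨u, hu, hup⟩ := hG p hp
      exact mem_biUnion.2 ⟨u, hu, mem_inter.2 ⟨mem_nb.2 hup, (mem_filter.1 hp).1⟩⟩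
    exact (card_le_card this).trans card_biUnion_le
  have c2 : ∑ u ∈ (cn (flip R) B)ᶜ \ Us, (k - #(nb R u ∩ B)) ≤
      ∑ u ∈ (cn (flip R) B)ᶜ \ Us, #(nb R u ∩ (cn R A \ B)) :=
    sum_le_sum fun u hu => hgU u (mem_sdiff.1 hu).1
  have c3 : ∑ u ∈ Us, (k - #(nb R u ∩ B)) ≤ ∑ u ∈ (cn (flip R) B)ᶜ, #(nb R u ∩ (cn R A)ᶜ) :=
    (sum_le_sum fun u hu => (mem_filter.1 hu).2).trans (sum_le_sum_of_subset hUsub)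
  have c4 := sum_sdiff (f := fun u => k - #(nb R u ∩ B)) hUsub
  have c5 := sum_sdiff (f := fun u => #(nb R u ∩ (cn R A \ B))) hUsub
  omega


theorem finish {R : α → β → Prop} {k n : ℕ} (h : Ctx R k n) (A : Finset α) (hA : #A = k)
    (hn : ((3 * k + 2) + (k * k + 4 * k + 2) * (1 + (k * k + 7 * k + 3))) * #((cn R A)ᶜ)
      + (2 * (k + 1) * (k + 2) + (k * k + 4 * k + 2) * (2 * (k + 1) * (k + 2)) + k) < n) :
    False := by
  obtain ⟨B, hB, hBA, hBc⟩ := stage2 h A hA (lt_of_le_of_lt (add_le_add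
    (Nat.mul_le_mul_right _ (Nat.le_add_right _ _))
    ((Nat.le_add_right _ _).trans (Nat.le_add_right _ _))) hn)
  have hAB : ∀ a ∈ A, ∀ b ∈ B, R a b := fun a ha b hb => mem_cn.1 (hBA hb) a ha
  have hn3 : (k * k + 4 * k + 2) * (#((cn R A)ᶜ) + #((cn (flip R) B)ᶜ)) + k < n := by
    have := Nat.mul_le_mul_left (k * k + 4 * k + 2) hBc
    nlinarith
  have hV := stage3 h A hA B hB hAB hn3
  have hU := stage3 h.flip B hB A hA (fun b hb a ha => hAB a ha b hb) (by
    rw [add_comm #_]; exact hn3)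
  exact stage4 h A hA B hB hAB hV hU

/-- vertices reachable from `u` by short walks avoiding the large vertices -/
noncomputable def Short {α : Type w₁} {β : Type w₂} [Fintype α] [Fintype β] (R : α → β → Prop)
    (LU : Finset α) (LV : Finset β) (u : α) : Finset β :=
  nb R u ∪ (nb R u \ LV).biUnion fun b => (nb (flip R) b \ LU).biUnion fun a => nb R a

theorem short_card {R : α → β → Prop} {LU : Finset α} {LV : Finset β} {M : ℕ}
    (hU : ∀ u, u ∉ LU → #(nb R u) ≤ M) (hV : ∀ v, v ∉ LV → #(nb (flip R) v) ≤ M) (u : α)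
    (hu : u ∉ LU) : #(Short R LU LV u) ≤ M + M * (M * M) := by
  refine le_trans (card_union_le _ _) (add_le_add (hU u hu) ?_)
  refine le_trans (card_biUnion_le_card_mul _ _ (M * M) ?_) ?_
  · intro b hb
    refine le_trans (card_biUnion_le_card_mul _ _ M ?_) ?_
    · intro a ha
      exact hU a (mem_sdiff.1 ha).2
    · exact Nat.mul_le_mul_right _ (le_trans (card_le_card sdiff_subset) (hV b (mem_sdiff.1 hb).2))
  · exact Nat.mul_le_mul_right _ (le_trans (card_le_card sdiff_subset) (hU u hu))

theorem short_sat {R : α → β → Prop} {k : ℕ} (h : Sat R k) (LU : Finset α) (LV : Finset β) {u : α}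
    {v : β} (hv : v ∉ Short R LU LV u) : ∃ (A : Finset α) (B : Finset β), A ⊆ nb (flip R) v ∧
    B ⊆ nb R u ∧ (∀ a ∈ A, ∀ b ∈ B, R a b) ∧ ((#A = k + 1 ∧ #B = k) ∨ (#A = k ∧ #B = k + 1)) ∧
    (A ⊆ LU ∨ B ⊆ LV) := by
  have hr : ¬ R u v := fun hr => hv (mem_union_left _ (mem_nb.2 hr))
  obtain ⟨A, B, h1, h2, h3, h4⟩ := h.sat u v hr
  refine ⟨A, B, fun a ha => mem_nb'.2 (h1 a ha), fun b hb => mem_nb.2 (h2 b hb), h3, h4, ?_⟩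
  by_contra hc
  rw [not_or, not_subset, not_subset] at hc
  obtain ⟨⟨a, ha, haL⟩, b, hb, hbL⟩ := hc
  apply hv
  apply mem_union_right
  rw [mem_biUnion]
  refine ⟨b, mem_sdiff.2 ⟨mem_nb.2 (h2 b hb), hbL⟩, ?_⟩
  rw [mem_biUnion]
  exact ⟨a, mem_sdiff.2 ⟨mem_nb'.2 (h3 a ha b hb), haL⟩, mem_nb.2 (h1 a ha)⟩

theorem exL {R : α → β → Prop} {k n : ℕ} (h : Ctx R k n) (LU : Finset α) :
    exc R k LU + ∑ v, (#(nb (flip R) v ∩ LU) - k) ≤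
      (k + 1) * #LU + k * #(univ.filter fun v => #(nb (flip R) v ∩ LU) < k) := by
  have h1 := ed_split R LU
  have h2 : ∑ u ∈ LUᶜ, #(nb R u) = (k + 1) * #(LUᶜ) + exc R k LU := by
    rw [exc, mul_comm, ← smul_eq_mul, ← sum_const, ← sum_add_distrib]
    exact sum_congr rfl fun u _ => by have := h.du u; omega
  have h3 : ∑ v, #(nb (flip R) v ∩ LU) + ∑ v, (k - #(nb (flip R) v ∩ LU))
      = n * k + ∑ v, (#(nb (flip R) v ∩ LU) - k) := by
    rw [← sum_add_distrib, ← h.hβ, ← card_univ, ← smul_eq_mul, ← sum_const, ← sum_add_distrib]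
    exact sum_congr rfl fun v _ => by omega
  have h6 : ∑ v, (k - #(nb (flip R) v ∩ LU)) ≤
      k * #(univ.filter fun v => #(nb (flip R) v ∩ LU) < k) := by
    rw [mul_comm, ← smul_eq_mul, ← sum_const, sum_filter]
    apply sum_le_sum
    intro v _
    split_ifs <;> omega
  have h4 : #LU + #(LUᶜ) = n := by rw [card_add_card_compl, h.hα]
  have h5 := h.lt
  generalize #(LUᶜ) = m at *
  subst h4
  nlinarith

theorem exL1 {R : α → β → Prop} {k n : ℕ} (h : Ctx R k n) (LU : Finset α) :
    #(univ.filter fun u => u ∉ LU ∧ #(nb R u) ≠ k + 1) ≤ exc R k LU := by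
  apply exc_single
  · intro u hu
    simp only [mem_filter] at hu
    simp [hu.2.1]
  · intro u hu
    simp only [mem_filter] at hu
    have := h.du u
    omega

theorem exL2 {R : α → β → Prop} {k : ℕ} (LU : Finset α) :
    #(univ.filter fun v => #(nb (flip R) v ∩ LU) ≠ k) ≤
      ∑ v, (#(nb (flip R) v ∩ LU) - k) + #(univ.filter fun v => #(nb (flip R) v ∩ LU) < k) := by
  rw [card_filter, card_filter, ← sum_add_distrib]
  apply sum_le_sum
  intro v _
  split_ifs <;> omega

theorem case1 {R : α → β → Prop} {k n : ℕ} (h : Ctx R k n) (LU : Finset α) (LV : Finset β) (u0 : α)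
    (hu0 : u0 ∉ LU) (hd : #(nb R u0) = k + 1) (hb : #(nb R u0 ∩ LV) < k)
    (hn : #(Short R LU LV u0) + #(univ.filter fun v => #(nb (flip R) v ∩ LU) ≠ k) < n) :
    ∃ A : Finset α, #A = k ∧ #((cn R A)ᶜ) ≤
      #(Short R LU LV u0) + #(univ.filter fun v => #(nb (flip R) v ∩ LU) ≠ k) := by
  set W := Short R LU LV u0 ∪ (univ.filter fun v => #(nb (flip R) v ∩ LU) ≠ k) with hW
  have hWc := card_union_le (Short R LU LV u0) (univ.filter fun v => #(nb (flip R) v ∩ LU) ≠ k)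
  rw [← hW] at hWc
  set A := (cn (flip R) (nb R u0)).erase u0 with hA
  have hu0c : u0 ∈ cn (flip R) (nb R u0) := mem_cn'.2 fun b hb => mem_nb.1 hb
  have hAk : #A ≤ k := by
    rw [hA, card_erase_of_mem hu0c]
    by_contra hc
    exact h.sat.free2 (cn (flip R) (nb R u0)) (nb R u0) (fun a ha b hb => mem_cn'.1 ha b hb)
      (by omega) (by omega)
  have key : ∀ v, v ∉ W → #A = k ∧ v ∈ cn R A := by
    intro v hv
    rw [hW, mem_union, not_or] at hv
    obtain ⟨hv1, hv2⟩ := hv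
    have hv2 : #(nb (flip R) v ∩ LU) = k := by simpa using hv2
    obtain ⟨A', B', hA', hB', hc, hk, hL⟩ := short_sat h.sat LU LV hv1
    rcases hL with hL | hL
    · have h1 := card_le_card (subset_inter hA' hL)
      have hBeq : B' = nb R u0 := eq_of_subset_of_card_le hB' (by omega)
      have h2 : A' ⊆ A := by
        intro a ha
        rw [hA, mem_erase]
        refine ⟨fun e => hu0 (e ▸ hL ha), ?_⟩
        rw [mem_cn', ← hBeq]
        exact hc a ha
      have h3 : A' = A := eq_of_subset_of_card_le h2 (by omega)
      refine ⟨by rw [← h3]; omega, ?_⟩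
      rw [mem_cn, ← h3]
      intro a ha
      exact mem_nb'.1 (hA' ha)
    · have h1 := card_le_card (subset_inter hB' hL)
      omega
  obtain ⟨v, hv⟩ : ∃ v, v ∉ W := by
    by_contra hc
    push Not at hc
    have : W = univ := by ext; simp [hc]
    rw [this, card_univ, h.hβ] at hWc
    omega
  refine ⟨A, (key v hv).1, le_trans (card_le_card ?_) hWc⟩
  intro v hv
  by_contra hc
  exact (mem_compl.1 hv) (key v hc).2

theorem dich {R : α → β → Prop} {k n : ℕ} (h : Ctx R k n) (LU : Finset α) (LV : Finset β)
    {u0 u : α} {v0 v : β} (e0 : R u0 v0) (e : R u v) (d0 : #(nb R u0) = k + 1)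
    (b0 : #(nb R u0 ∩ LV) = k) (b : #(nb R u ∩ LV) = k) (d : #(nb (flip R) v) = k + 1)
    (a0 : #(nb (flip R) v0 ∩ LU) = k) (a : #(nb (flip R) v ∩ LU) = k)
    (hv : v ∉ Short R LU LV u0) :
    nb (flip R) v ∩ LU = nb (flip R) v0 ∩ LU ∨ nb R u ∩ LV = nb R u0 ∩ LV := by
  obtain ⟨A', B', hA', hB', hc, hk, hL⟩ := short_sat h.sat LU LV hv
  rcases hL with hL | hL
  · left
    have h1 := card_le_card (subset_inter hA' hL)
    have h2 : A' = nb (flip R) v ∩ LU := eq_of_subset_of_card_le (subset_inter hA' hL) (by omega)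
    have h3 : B' = nb R u0 := eq_of_subset_of_card_le hB' (by omega)
    rw [← h2]
    refine eq_of_subset_of_card_le (subset_inter ?_ hL) (by omega)
    intro x hx
    exact mem_nb'.2 (hc x hx v0 (by rw [h3]; exact mem_nb.2 e0))
  · right
    have h1 := card_le_card (subset_inter hB' hL)
    have h2 : B' = nb R u0 ∩ LV := eq_of_subset_of_card_le (subset_inter hB' hL) (by omega)
    have h3 : A' = nb (flip R) v := eq_of_subset_of_card_le hA' (by omega)
    rw [← h2]
    symm
    refine eq_of_subset_of_card_le (subset_inter ?_ hL) (by omega)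
    intro x hx
    exact mem_nb.2 (hc u (by rw [h3]; exact mem_nb'.2 e) x hx)

/-- atypical vertices -/
noncomputable def Wd {α : Type w₁} {β : Type w₂} [Fintype α] [Fintype β] (R : α → β → Prop) (k : ℕ)
    (LU : Finset α) (LV : Finset β) : Finset α :=
  univ.filter fun u => u ∈ LU ∨ #(nb R u) ≠ k + 1 ∨ #(nb R u ∩ LV) ≠ k

/-- endpoints of good edges -/
noncomputable def Gd {α : Type w₁} {β : Type w₂} [Fintype α] [Fintype β] (R : α → β → Prop) (k : ℕ)
    (LU : Finset α) (LV : Finset β) : Finset β :=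
  univ.filter fun v => v ∉ Wd (flip R) k LV LU ∧ ∃ u, u ∉ Wd R k LU LV ∧ R u v

theorem not_mem_Wd {R : α → β → Prop} {k : ℕ} {LU : Finset α} {LV : Finset β} {u : α} :
    u ∉ Wd R k LU LV ↔ u ∉ LU ∧ #(nb R u) = k + 1 ∧ #(nb R u ∩ LV) = k := by
  simp [Wd, not_or]

theorem Gd_card {R : α → β → Prop} {k n : ℕ} (h : Ctx R k n) (LU : Finset α) (LV : Finset β) :
    #((Gd R k LU LV)ᶜ) ≤ #(Wd (flip R) k LV LU) + (k + 1) * #(Wd R k LU LV) + exc R k LU := by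
  have h1 : (Gd R k LU LV)ᶜ ⊆ Wd (flip R) k LV LU ∪
      (Wd R k LU LV \ LU).biUnion fun u => nb R u := by
    intro v hv
    by_cases hw : v ∈ Wd (flip R) k LV LU
    · exact mem_union_left _ hw
    apply mem_union_right
    have hg : ¬ ∃ u, u ∉ Wd R k LU LV ∧ R u v := by
      intro hc
      exact (mem_compl.1 hv) (by simp [Gd, hw, hc])
    obtain ⟨-, h2, h3⟩ := not_mem_Wd.1 hw
    have h4 : ¬ nb (flip R) v ⊆ LU := by
      intro hc
      rw [inter_eq_left.2 hc] at h3
      omega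
    obtain ⟨u, hu, huL⟩ := not_subset.1 h4
    rw [mem_biUnion]
    refine ⟨u, mem_sdiff.2 ⟨?_, huL⟩, mem_nb.2 (mem_nb'.1 hu)⟩
    by_contra hc
    exact hg ⟨u, hc, mem_nb'.1 hu⟩
  have h2 := exc_eq h LU (Wd R k LU LV \ LU) (by
    intro u hu
    exact mem_compl.2 (mem_sdiff.1 hu).2)
  have h3 : #((Wd R k LU LV \ LU).biUnion fun u => nb R u) ≤ ∑ u ∈ Wd R k LU LV \ LU, #(nb R u) :=
    card_biUnion_le
  have h4 := card_le_card h1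
  have h5 := card_union_le (Wd (flip R) k LV LU) ((Wd R k LU LV \ LU).biUnion fun u => nb R u)
  have h6 : (k + 1) * #(Wd R k LU LV \ LU) ≤ (k + 1) * #(Wd R k LU LV) :=
    Nat.mul_le_mul_left _ (card_le_card sdiff_subset)
  omega

theorem case2 {R : α → β → Prop} {k n J : ℕ} (h : Ctx R k n) (LU : Finset α) (LV : Finset β)
    (hJ : ∀ u, u ∉ LU → #(Short R LU LV u) ≤ J) (hn : #((Gd R k LU LV)ᶜ) < n) :
    (∃ A : Finset α, #A = k ∧ #((cn R A)ᶜ) ≤ #((Gd R k LU LV)ᶜ) + 2 * J) ∨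
    (∃ B : Finset β, #B = k ∧
      #((cn (flip R) B)ᶜ) ≤ #((Gd (flip R) k LV LU)ᶜ) + (k + 1) * J) := by
  obtain ⟨v0, hv0⟩ : ∃ v, v ∈ Gd R k LU LV := by
    by_contra hc
    push Not at hc
    have : (Gd R k LU LV)ᶜ = univ := by ext; simp [hc]
    rw [this, card_univ, h.hβ] at hn
    omega
  simp only [Gd, mem_filter, mem_univ, true_and] at hv0
  obtain ⟨gv0, u0, gu0, e0⟩ := hv0
  obtain ⟨u0L, u0d, u0b⟩ := not_mem_Wd.1 gu0
  obtain ⟨v0L, v0d, v0a⟩ := not_mem_Wd.1 gv0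
  by_cases hc : ∃ ur vr, ur ∉ Wd R k LU LV ∧ vr ∉ Wd (flip R) k LV LU ∧ R ur vr ∧
      vr ∉ Short R LU LV u0 ∧ nb R ur ∩ LV ≠ nb R u0 ∩ LV
  · left
    obtain ⟨ur, vr, gur, gvr, er, vrS, hne⟩ := hc
    obtain ⟨urL, urd, urb⟩ := not_mem_Wd.1 gur
    obtain ⟨vrL, vrd, vra⟩ := not_mem_Wd.1 gvr
    have hA : nb (flip R) vr ∩ LU = nb (flip R) v0 ∩ LU :=
      (dich h LU LV e0 er u0d u0b urb vrd v0a vra vrS).resolve_right hne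
    refine ⟨nb (flip R) v0 ∩ LU, v0a, ?_⟩
    have hs : (cn R (nb (flip R) v0 ∩ LU))ᶜ ⊆
        (Gd R k LU LV)ᶜ ∪ (Short R LU LV u0 ∪ Short R LU LV ur) := by
      intro v hv
      by_contra hcv
      simp only [mem_union, not_or, mem_compl, not_not] at hcv
      obtain ⟨hg, hs0, hsr⟩ := hcv
      simp only [Gd, mem_filter, mem_univ, true_and] at hg
      obtain ⟨gv, u, gu, e⟩ := hg
      obtain ⟨uL, ud, ub⟩ := not_mem_Wd.1 gu
      obtain ⟨vL, vd, va⟩ := not_mem_Wd.1 gv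
      have hA' : nb (flip R) v ∩ LU = nb (flip R) v0 ∩ LU := by
        rcases dich h LU LV e0 e u0d u0b ub vd v0a va hs0 with h1 | h1
        · exact h1
        rcases dich h LU LV er e urd urb ub vd vra va hsr with h2 | h2
        · rw [h2, hA]
        · exact absurd (h2.symm.trans h1) hne
      apply mem_compl.1 hv
      rw [mem_cn, ← hA']
      intro a ha
      exact mem_nb'.1 (mem_inter.1 ha).1
    have h1 := card_le_card hs
    have h2 := card_union_le (Gd R k LU LV)ᶜ (Short R LU LV u0 ∪ Short R LU LV ur)
    have h3 := card_union_le (Short R LU LV u0) (Short R LU LV ur)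
    have h4 := hJ u0 u0L
    have h5 := hJ ur urL
    omega
  · right
    push Not at hc
    refine ⟨nb R u0 ∩ LV, u0b, ?_⟩
    have hs : (cn (flip R) (nb R u0 ∩ LV))ᶜ ⊆ (Gd (flip R) k LV LU)ᶜ ∪
        (Short R LU LV u0 \ Wd (flip R) k LV LU).biUnion fun v => nb (flip R) v := by
      intro u hu
      by_contra hcu
      simp only [mem_union, not_or, mem_compl, not_not] at hcu
      obtain ⟨hg, hs0⟩ := hcu
      simp only [Gd, mem_filter, mem_univ, true_and] at hg
      obtain ⟨gu, v, gv, e⟩ := hg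
      have hvS : v ∉ Short R LU LV u0 := by
        intro hvS
        apply hs0
        rw [mem_biUnion]
        exact ⟨v, mem_sdiff.2 ⟨hvS, gv⟩, mem_nb'.2 e⟩
      have hB := hc u v gu gv e hvS
      apply mem_compl.1 hu
      rw [mem_cn', ← hB]
      intro b hb
      exact mem_nb.1 (mem_inter.1 hb).1
    have h1 := card_le_card hs
    have h2 := card_union_le (Gd (flip R) k LV LU)ᶜ
      ((Short R LU LV u0 \ Wd (flip R) k LV LU).biUnion fun v => nb (flip R) v)
    have h3 : #((Short R LU LV u0 \ Wd (flip R) k LV LU).biUnion fun v => nb (flip R) v) ≤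
        #(Short R LU LV u0 \ Wd (flip R) k LV LU) * (k + 1) := by
      apply card_biUnion_le_card_mul
      intro v hv
      exact (not_mem_Wd.1 (mem_sdiff.1 hv).2).2.1.le
    have h4 : #(Short R LU LV u0 \ Wd (flip R) k LV LU) ≤ J :=
      le_trans (card_le_card sdiff_subset) (hJ u0 u0L)
    nlinarith


theorem Wd_card {R : α → β → Prop} {k n : ℕ} (h : Ctx R k n) (LU : Finset α) (LV : Finset β) :
    #(Wd R k LU LV) ≤ #LU + exc R k LU + #(univ.filter fun u => #(nb R u ∩ LV) ≠ k) := by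
  have h1 : Wd R k LU LV ⊆ (LU ∪ univ.filter fun u => u ∉ LU ∧ #(nb R u) ≠ k + 1) ∪
      (univ.filter fun u => #(nb R u ∩ LV) ≠ k) := by
    intro u hu
    simp only [Wd, mem_filter, mem_univ, true_and, mem_union] at hu ⊢
    tauto
  have h2 := card_le_card h1
  have h3 := card_union_le (LU ∪ univ.filter fun u => u ∉ LU ∧ #(nb R u) ≠ k + 1)
    (univ.filter fun u => #(nb R u ∩ LV) ≠ k)
  have h4 := card_union_le LU (univ.filter fun u => u ∉ LU ∧ #(nb R u) ≠ k + 1)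
  have h5 := exL1 h LU
  omega

theorem stage1a {R : α → β → Prop} {k n m : ℕ} (h : Ctx R k n) (LU : Finset α) (LV : Finset β)
    (hJ : ∀ u, u ∉ LU → #(Short R LU LV u) ≤ m) (ha : #LU ≤ m) (hb : #LV ≤ m)
    (hq : #(univ.filter fun v => #(nb (flip R) v ∩ LU) < k) ≤ m)
    (hn : 24 * (k + 1) ^ 3 * m < n) :
    (∃ A : Finset α, #A = k ∧ #((cn R A)ᶜ) ≤ 24 * (k + 1) ^ 3 * m) ∨
    (∃ B : Finset β, #B = k ∧ #((cn (flip R) B)ᶜ) ≤ 24 * (k + 1) ^ 3 * m) := by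
  have e1 := exL h LU
  have e2 := exL2 (R := R) (k := k) LU
  obtain ⟨K, hK⟩ : ∃ K, K = k + 1 := ⟨_, rfl⟩
  have hK1 : 1 ≤ K := by omega
  have hX : (k + 1) * #LU + k * #(univ.filter fun v => #(nb (flip R) v ∩ LU) < k) ≤ 2 * K * m := by
    have h1 := Nat.mul_le_mul_left (k + 1) ha
    have h2 := Nat.mul_le_mul_left k hq
    rw [hK]
    nlinarith
  have p1 : m ≤ K * m := Nat.le_mul_of_pos_left _ hK1
  have p2 : K * m ≤ K ^ 2 * m := Nat.mul_le_mul_right _ (Nat.le_self_pow (by norm_num) _)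
  have p3 : K ^ 2 * m ≤ K ^ 3 * m := Nat.mul_le_mul_right _ (Nat.pow_le_pow_right hK1 (by norm_num))
  rw [← hK] at hn ⊢ hX e1
  by_cases hc : ∃ u0, u0 ∉ LU ∧ #(nb R u0) = k + 1 ∧ #(nb R u0 ∩ LV) < k
  · left
    obtain ⟨u0, hu0, hd, hβ⟩ := hc
    have hS := hJ u0 hu0
    obtain ⟨A, hA, hAc⟩ := case1 h LU LV u0 hu0 hd hβ (by nlinarith)
    exact ⟨A, hA, by nlinarith⟩
  · have hp : #(univ.filter fun u => #(nb R u ∩ LV) < k) ≤ #LU + exc R k LU := by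
      refine le_trans (card_le_card ?_) (le_trans (card_union_le LU _)
        (Nat.add_le_add_left (exL1 h LU) _))
      intro u hu
      simp only [mem_filter, mem_univ, true_and, mem_union] at hu ⊢
      by_contra hcc
      push Not at hcc
      exact hc ⟨u, hcc.1, hcc.2 hcc.1, hu⟩
    have f1 := exL h.flip LV
    have f2 := exL2 (R := flip R) (k := k) LV
    have ff : flip (flip R) = R := rfl
    rw [ff] at f1 f2
    have hY : (k + 1) * #LV + k * #(univ.filter fun u => #(nb R u ∩ LV) < k) ≤
        4 * K ^ 2 * m := by
      have h1 := Nat.mul_le_mul_left (k + 1) hb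
      have h2 : #(univ.filter fun u => #(nb R u ∩ LV) < k) ≤ 3 * K * m := by nlinarith
      have h3 := Nat.mul_le_mul_left k h2
      have h4 : k * (3 * K * m) ≤ K * (3 * K * m) := Nat.mul_le_mul_right _ (by omega)
      rw [← hK] at h1 ⊢
      nlinarith
    rw [← hK] at f1
    have wU := Wd_card h LU LV
    have wV := Wd_card h.flip LV LU
    rw [← hK] at hY
    have x1 : exc R k LU ≤ 2 * K * m := by omega
    have x2 : #(univ.filter fun v => #(nb (flip R) v ∩ LU) ≠ k) ≤ 2 * K * m + m := by omega
    have y1 : exc (flip R) k LV ≤ 4 * K ^ 2 * m := by omega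
    have hp' : #(univ.filter fun u => #(nb R u ∩ LV) < k) ≤ m + 2 * K * m := by omega
    have y2 : #(univ.filter fun u => #(nb R u ∩ LV) ≠ k) ≤ 4 * K ^ 2 * m + (m + 2 * K * m) := by
      omega
    clear e1 e2 f1 f2 hX hY
    have wU' : #(Wd R k LU LV) ≤ 10 * K ^ 2 * m := by linarith
    have wV' : #(Wd (flip R) k LV LU) ≤ 8 * K ^ 2 * m := by linarith
    have gV := Gd_card h LU LV
    have gU := Gd_card h.flip LV LU
    rw [ff] at gU
    rw [← hK] at gU gV
    have t1 := Nat.mul_le_mul_left K wU'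
    have t2 := Nat.mul_le_mul_left K wV'
    have gV' : #((Gd R k LU LV)ᶜ) ≤ 20 * K ^ 3 * m := by linarith
    have gU' : #((Gd (flip R) k LV LU)ᶜ) ≤ 22 * K ^ 3 * m := by linarith
    rcases case2 h LU LV hJ (by linarith) with ⟨A, hA, hAc⟩ | ⟨B, hB, hBc⟩
    · exact Or.inl ⟨A, hA, by linarith⟩
    · rw [← hK] at hBc
      exact Or.inr ⟨B, hB, by linarith⟩

theorem large_card {R : α → β → Prop} {k n C : ℕ} (h : Ctx R k n) :
    C * #(univ.filter fun u => (2 * k + 1) * C ≤ #(nb R u)) ≤ n := by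
  have h1 : #(univ.filter fun u => (2 * k + 1) * C ≤ #(nb R u)) * ((2 * k + 1) * C) ≤ ed R := by
    refine le_trans ?_ (sum_le_sum_of_subset (filter_subset
      (fun u => (2 * k + 1) * C ≤ #(nb R u)) univ))
    rw [← smul_eq_mul]
    exact card_nsmul_le_sum _ _ _ fun u hu => (mem_filter.1 hu).2
  have h2 := h.lt
  have h3 : (2 * k + 1) * (C * #(univ.filter fun u => (2 * k + 1) * C ≤ #(nb R u)))
      ≤ (2 * k + 1) * n := by nlinarith
  exact Nat.le_of_mul_le_mul_left h3 (by omega)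

theorem ctx_false (k : ℕ) : ∃ N, ∀ n, N ≤ n → ∀ (α : Type w₁) (β : Type w₂) [Fintype α] [Fintype β]
    (R : α → β → Prop), ¬ Ctx R k n := by
  obtain ⟨P, hP⟩ : ∃ P, P = (3 * k + 2) + (k * k + 4 * k + 2) * (1 + (k * k + 7 * k + 3)) := ⟨_, rfl⟩
  obtain ⟨Q, hQ⟩ : ∃ Q, Q = 2 * (k + 1) * (k + 2) +
    (k * k + 4 * k + 2) * (2 * (k + 1) * (k + 2)) + k := ⟨_, rfl⟩
  have hP1 : 1 ≤ P := by rw [hP]; omega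
  obtain ⟨D, hD⟩ : ∃ D, D = 24 * (k + 1) ^ 3 := ⟨_, rfl⟩
  have hD1 : 1 ≤ D := by rw [hD]; have : 0 < (k + 1) ^ 3 := by positivity
                         omega
  obtain ⟨C, hC⟩ : ∃ C, C = 2 * (P * D) := ⟨_, rfl⟩
  have hC1 : 1 ≤ C := by rw [hC]; have : 0 < P * D := by positivity
                         omega
  obtain ⟨M, hM⟩ : ∃ M, M = (2 * k + 1) * C := ⟨_, rfl⟩
  refine ⟨2 * Q + 1 + C * (M + M * (M * M)), ?_⟩
  intro n hn α β _ _ R h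
  obtain ⟨m, hm⟩ : ∃ m, m = n / C := ⟨_, rfl⟩
  have hCm : C * m ≤ n := by rw [hm]; exact Nat.mul_div_le n C
  have le_m : ∀ x, C * x ≤ n → x ≤ m := by
    intro x hx
    rw [hm, Nat.le_div_iff_mul_le (by omega), mul_comm]
    exact hx
  have hPDm : P * (D * m) + Q < n := by
    have : C * m = 2 * (P * (D * m)) := by rw [hC]; ring
    omega
  have hDm : D * m < n := by
    have : D * m ≤ P * (D * m) := Nat.le_mul_of_pos_left _ hP1
    omega
  have hJm : M + M * (M * M) ≤ m := le_m _ (by omega)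
  obtain ⟨LU, hLU⟩ : ∃ L : Finset α, L = univ.filter fun u => (2 * k + 1) * C ≤ #(nb R u) := ⟨_, rfl⟩
  obtain ⟨LV, hLV⟩ : ∃ L : Finset β, L = univ.filter fun v => (2 * k + 1) * C ≤ #(nb (flip R) v) :=
    ⟨_, rfl⟩
  have ha : #LU ≤ m := by rw [hLU]; exact le_m _ (large_card h)
  have hb : #LV ≤ m := by rw [hLV]; exact le_m _ (large_card h.flip)
  have hU : ∀ u, u ∉ LU → #(nb R u) ≤ M := by
    intro u hu
    rw [hLU] at hu
    simp only [mem_filter, mem_univ, true_and] at hu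
    omega
  have hV : ∀ v, v ∉ LV → #(nb (flip R) v) ≤ M := by
    intro u hu
    rw [hLV] at hu
    simp only [mem_filter, mem_univ, true_and] at hu
    omega
  have sU : ∀ u, u ∉ LU → #(Short R LU LV u) ≤ m := fun u hu => (short_card hU hV u hu).trans hJm
  have sV : ∀ v, v ∉ LV → #(Short (flip R) LV LU v) ≤ m :=
    fun v hv => (short_card hV hU v hv).trans hJm
  have fin1 : ∀ A : Finset α, #A = k → #((cn R A)ᶜ) ≤ D * m → False := by
    intro A hA hAc
    apply finish h A hA
    rw [← hP, ← hQ]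
    have := Nat.mul_le_mul_left P hAc
    omega
  have fin2 : ∀ B : Finset β, #B = k → #((cn (flip R) B)ᶜ) ≤ D * m → False := by
    intro A hA hAc
    apply finish h.flip A hA
    rw [← hP, ← hQ]
    have := Nat.mul_le_mul_left P hAc
    omega
  by_cases hc : ∃ u, u ∉ LU ∧ #(nb R u ∩ LV) < k
  · obtain ⟨u, hu, hul⟩ := hc
    have hq : #(univ.filter fun v => #(nb (flip R) v ∩ LU) < k) ≤ m := by
      refine le_trans (card_le_card ?_) (sU u hu)
      intro v hv
      simp only [mem_filter, mem_univ, true_and] at hv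
      by_contra hvS
      obtain ⟨A', B', hA', hB', hc, hk, hL⟩ := short_sat h.sat LU LV hvS
      rcases hL with hL | hL
      · have := card_le_card (subset_inter hA' hL)
        omega
      · have := card_le_card (subset_inter hB' hL)
        omega
    rcases stage1a h LU LV sU ha hb hq (by rw [← hD]; exact hDm) with ⟨A, hA, hAc⟩ | ⟨B, hB, hBc⟩
    · exact fin1 A hA (by rw [hD]; exact hAc)
    · exact fin2 B hB (by rw [hD]; exact hBc)
  · have hq : #(univ.filter fun u => #(nb R u ∩ LV) < k) ≤ m := by
      refine le_trans (card_le_card ?_) ha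
      intro u hu
      simp only [mem_filter, mem_univ, true_and] at hu
      by_contra hcc
      exact hc ⟨u, hcc, hu⟩
    rcases stage1a h.flip LV LU sV hb ha hq (by rw [← hD]; exact hDm) with
      ⟨A, hA, hAc⟩ | ⟨B, hB, hBc⟩
    · exact fin2 A hA (by rw [hD]; exact hAc)
    · exact fin1 B hB (by rw [hD]; exact hBc)

theorem lower (k : ℕ) : ∃ N, ∀ n, N ≤ n → ∀ (α : Type w₁) (β : Type w₂) [Fintype α] [Fintype β]
    (R : α → β → Prop), Fintype.card α = n → Fintype.card β = n → Sat R k →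
    (2 * k + 1) * n ≤ ed R + k * (k + 1) := by
  obtain ⟨N, hN⟩ := ctx_false.{w₁, w₂} k
  refine ⟨N + k, ?_⟩
  intro n hn α β _ _ R hα hβ h
  by_contra hlt
  have gu := h.deg_ge (by omega)
  have gv := h.flip.deg_ge (by omega)
  refine hN n (by omega) α β R ⟨h, hα, hβ, ?_, ?_, by omega⟩
  · intro u
    by_contra hc
    have := gu u
    exact hlt (caseK h hα hβ (by omega) u (by omega))
  · intro v
    by_contra hc
    have := gv v
    have := caseK h.flip hβ hα (by omega) v (by omega)
    rw [ed_flip] at this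
    exact hlt this

end Dev

theorem sat_of_frozen {n k : ℕ} {E : Finset (Fin n × Fin n)} (h : SaturatedKst n E (k + 1) (k + 2)) :
    Sat (fun u v => (u, v) ∈ E) k := by
  have f1 : ∀ (S T : Finset (Fin n)), (∀ a ∈ S, ∀ b ∈ T, (a, b) ∈ E) →
      k + 1 ≤ #S → k + 2 ≤ #T → False := by
    intro S T hc hS hT
    obtain ⟨S', hS', hS2⟩ := exists_subset_card_eq hS
    obtain ⟨T', hT', hT2⟩ := exists_subset_card_eq hT
    exact h.1 (Or.inl ⟨S', T', hS2, hT2, fun a ha b hb => hc a (hS' ha) b (hT' hb)⟩)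
  have f2 : ∀ (S T : Finset (Fin n)), (∀ a ∈ S, ∀ b ∈ T, (a, b) ∈ E) →
      k + 2 ≤ #S → k + 1 ≤ #T → False := by
    intro S T hc hS hT
    obtain ⟨S', hS', hS2⟩ := exists_subset_card_eq hS
    obtain ⟨T', hT', hT2⟩ := exists_subset_card_eq hT
    exact h.1 (Or.inr ⟨S', T', hS2, hT2, fun a ha b hb => hc a (hS' ha) b (hT' hb)⟩)
  refine ⟨f1, f2, ?_⟩
  intro u v hn
  have key : ∃ S T : Finset (Fin n), ((#S = k + 1 ∧ #T = k + 2) ∨ (#S = k + 2 ∧ #T = k + 1)) ∧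
      ∀ a ∈ S, ∀ b ∈ T, (a, b) ∈ insert (u, v) E := by
    rcases h.2 u v hn with ⟨S, T, h1, h2, h3⟩ | ⟨S, T, h1, h2, h3⟩
    · exact ⟨S, T, Or.inl ⟨h1, h2⟩, h3⟩
    · exact ⟨S, T, Or.inr ⟨h1, h2⟩, h3⟩
  obtain ⟨S, T, hk, hc⟩ := key
  have hc' : ∀ a ∈ S, ∀ b ∈ T, (a ≠ u ∨ b ≠ v) → (a, b) ∈ E := by
    intro a ha b hb hab
    rcases mem_insert.1 (hc a ha b hb) with h1 | h1
    · rw [Prod.mk.injEq] at h1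
      tauto
    · exact h1
  have huv : u ∈ S ∧ v ∈ T := by
    by_contra hcc
    have hE : ∀ a ∈ S, ∀ b ∈ T, (a, b) ∈ E := by
      intro a ha b hb
      apply hc' a ha b hb
      by_contra h3
      push Not at h3
      exact hcc ⟨h3.1 ▸ ha, h3.2 ▸ hb⟩
    rcases hk with h1 | h1
    · exact f1 S T hE (by omega) (by omega)
    · exact f2 S T hE (by omega) (by omega)
  refine ⟨S.erase u, T.erase v, ?_, ?_, ?_, ?_⟩
  · intro a ha
    exact hc' a (mem_of_mem_erase ha) v huv.2 (Or.inl (ne_of_mem_erase ha))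
  · intro b hb
    exact hc' u huv.1 b (mem_of_mem_erase hb) (Or.inr (ne_of_mem_erase hb))
  · intro a ha b hb
    exact hc' a (mem_of_mem_erase ha) b (mem_of_mem_erase hb) (Or.inl (ne_of_mem_erase ha))
  · rw [card_erase_of_mem huv.1, card_erase_of_mem huv.2]
    omega

theorem ed_eq {n : ℕ} (E : Finset (Fin n × Fin n)) : ed (fun u v => (u, v) ∈ E) = #E := by
  classical
  rw [ed, card_eq_sum_card_fiberwise (f := Prod.fst) (t := univ) (by simp)]
  apply sum_congr rfl
  intro u _
  apply card_bij (fun v _ => (u, v))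
  · intro v hv
    simpa [mem_nb] using hv
  · intro a _ b _ hab
    simpa using hab
  · rintro ⟨a, b⟩ hab
    simp only [mem_filter] at hab
    obtain ⟨h1, rfl⟩ := hab
    exact ⟨b, by simpa [mem_nb] using h1, rfl⟩

/-- the extremal graph -/
def ext0 (n k : ℕ) : Finset (Fin n × Fin n) :=
  univ.filter fun p => p.1.val < k ∨ p.2.val < k ∨ p.1 = p.2

theorem mem_ext0 {n k : ℕ} {u v : Fin n} :
    (u, v) ∈ ext0 n k ↔ u.val < k ∨ v.val < k ∨ u = v := by simp [ext0]

theorem low_card {n k : ℕ} (hk : k ≤ n) : #(univ.filter fun i : Fin n => i.val < k) = k := by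
  rw [Fin.card_filter_val_lt]; omega

theorem ext0_card {n k : ℕ} (hk : k ≤ n) : #(ext0 n k) + (k + 1) * k = (2 * k + 1) * n := by
  classical
  rw [← ed_eq, ed]
  have h1 : ∀ u : Fin n, #(nb (fun u v => (u, v) ∈ ext0 n k) u) = if u.val < k then n else k + 1 := by
    intro u
    split_ifs with hu
    · have : nb (fun u v => (u, v) ∈ ext0 n k) u = univ := by
        ext v; simp [mem_nb, mem_ext0, hu]
      rw [this, card_univ, Fintype.card_fin]
    · have : nb (fun u v => (u, v) ∈ ext0 n k) u = insert u (univ.filter fun i : Fin n => i.val < k) := by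
        ext v; simp [mem_nb, mem_ext0, hu, or_comm, eq_comm]
      rw [this, card_insert_of_notMem (by simpa using hu), low_card hk]
  rw [sum_congr rfl fun u _ => h1 u, sum_ite, sum_const, sum_const, low_card hk]
  have h2 := card_filter_add_card_filter_not (s := (univ : Finset (Fin n))) (fun i : Fin n => i.val < k)
  rw [low_card hk, card_univ, Fintype.card_fin] at h2
  generalize #(univ.filter fun i : Fin n => ¬ i.val < k) = m at *
  subst h2
  simp only [smul_eq_mul]
  ring

theorem ext0_aux {n k : ℕ} (hk : k ≤ n) (S T : Finset (Fin n)) (hS : #S = k + 1) (hT : #T = k + 2) :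
    ∃ u ∈ S, ∃ v ∈ T, ¬ (u.val < k) ∧ ¬ (v.val < k) ∧ u ≠ v := by
  obtain ⟨u, hu, huk⟩ : ∃ u ∈ S, u ∉ univ.filter fun i : Fin n => i.val < k :=
    exists_mem_notMem_of_card_lt_card (by rw [low_card hk]; omega)
  have huk' : ¬ u.val < k := by simpa using huk
  obtain ⟨v, hv, hvk⟩ : ∃ v ∈ T, v ∉ insert u (univ.filter fun i : Fin n => i.val < k) :=
    exists_mem_notMem_of_card_lt_card (by
      rw [card_insert_of_notMem huk, low_card hk]; omega)
  refine ⟨u, hu, v, hv, huk', ?_⟩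
  simp only [mem_insert, mem_filter, mem_univ, true_and, not_or] at hvk
  exact ⟨hvk.2, fun e => hvk.1 e.symm⟩

theorem ext0_sat {n k : ℕ} (hk : k ≤ n) : SaturatedKst n (ext0 n k) (k + 1) (k + 2) := by
  refine ⟨?_, ?_⟩
  · rintro (⟨S, T, hS, hT, hc⟩ | ⟨S, T, hS, hT, hc⟩)
    · obtain ⟨u, hu, v, hv, h1, h2, h3⟩ := ext0_aux hk S T hS hT
      have := mem_ext0.1 (hc u hu v hv)
      tauto
    · obtain ⟨u, hu, v, hv, h1, h2, h3⟩ := ext0_aux hk T S hT hS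
      have := mem_ext0.1 (hc v hv u hu)
      have h4 : v ≠ u := h3.symm
      tauto
  · intro u v huv
    rw [mem_ext0, not_or, not_or] at huv
    obtain ⟨h1, h2, h3⟩ := huv
    left
    refine ⟨insert u (univ.filter fun i : Fin n => i.val < k),
      insert v (insert u (univ.filter fun i : Fin n => i.val < k)), ?_, ?_, ?_⟩
    · rw [card_insert_of_notMem (by simpa using h1), low_card hk]
    · rw [card_insert_of_notMem, card_insert_of_notMem (by simpa using h1), low_card hk]
      simp only [mem_insert, mem_filter, mem_univ, true_and, not_or]
      exact ⟨fun e => h3 e.symm, h2⟩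
    · intro a ha b hb
      simp only [mem_insert, mem_filter, mem_univ, true_and] at ha hb
      rw [mem_insert, mem_ext0]
      rcases ha with rfl | ha
      · rcases hb with rfl | rfl | hb
        · left; rfl
        · right; right; right; rfl
        · right; right; left; exact hb
      · right; left; exact ha


/-- Theorem 1.2: for every `t ≥ 2` and all sufficiently large
`n`, `sat(K_{n,n}, K_{t-1,t}) = (2t-3)n - (t-1)(t-2)`: every `K_{t-1,t}`-
saturated `n` by `n` bipartite graph has at least `(2t-3)n - (t-1)(t-2)` edges,
and some such graph attains this value. -/
theorem stmt19 (t : ℕ) (ht : 2 ≤ t) :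
    ∃ N : ℕ, ∀ n : ℕ, N ≤ n →
      (∀ E : Finset (Fin n × Fin n), SaturatedKst n E (t - 1) t →
          (2 * t - 3) * n ≤ E.card + (t - 1) * (t - 2)) ∧
      (∃ E : Finset (Fin n × Fin n), SaturatedKst n E (t - 1) t ∧
          E.card + (t - 1) * (t - 2) = (2 * t - 3) * n) := by
  obtain ⟨k, rfl⟩ := Nat.exists_eq_add_of_le' ht
  obtain ⟨N, hN⟩ := lower.{0, 0} k
  have e1 : k + 2 - 1 = k + 1 := by omega
  have e2 : 2 * (k + 2) - 3 = 2 * k + 1 := by omega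
  have e3 : k + 2 - 2 = k := by omega
  rw [e1, e2, e3]
  refine ⟨N + k, fun n hn => ⟨?_, ?_⟩⟩
  · intro E hE
    have := hN n (by omega) (Fin n) (Fin n) (fun u v => (u, v) ∈ E) (Fintype.card_fin n)
      (Fintype.card_fin n) (sat_of_frozen hE)
    rw [ed_eq] at this
    rw [mul_comm (k + 1) k]
    exact this
  · exact ⟨ext0 n k, ext0_sat (by omega), ext0_card (by omega)⟩
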